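/- arXiv:1605.05750 — 3 statements merged into one kernel-verified Lean document; each statement's English description precedes it below -/
import Mathlib

section
/- Let u ∈ 𝒰 be a critical point of 𝓔ᵃ, i.e. ∂_F V^surf(u'₀) + ∂₁V(u'₀, u'₁) = 0 and ∂₂V(u'_{ℓ−1}, u'_ℓ) + ∂₁V(u'_ℓ, u'_{ℓ+1}) = 0 for every ℓ ≥ 1. Then there exist a constant C > 0 and 0 ≤ μₐ < 1 such that |u'_ℓ| ≤ C · μₐ^ℓ for all ℓ ∈ ℤ_{≥0}; that is, the strain of any critical point decays exponentially away from the surface. -/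
open scoped BigOperators ENNReal
open Filter MeasureTheory

noncomputable section

/-- discrete strain: `u'_ℓ = u_{ℓ+1} - u_ℓ` -/
def du (u : ℕ → ℝ) (ℓ : ℕ) : ℝ := u (ℓ + 1) - u ℓ

/-- second difference of strains: `u''_ℓ = u'_{ℓ+1} - u'_ℓ` -/
def ddu (u : ℕ → ℝ) (ℓ : ℕ) : ℝ := du u (ℓ + 1) - du u ℓ

/-- the displacement space 𝒰 -/
def memU (u : ℕ → ℝ) : Prop := u 0 = 0 ∧ Summable (fun ℓ => (du u ℓ) ^ 2)

/-- ℓ² norm of a sequence -/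
def l2 (e : ℕ → ℝ) : ℝ := Real.sqrt (∑' ℓ, (e ℓ) ^ 2)

/-- compactly supported lattice function -/
def FinSupp (u : ℕ → ℝ) : Prop := ∃ N : ℕ, ∀ ℓ : ℕ, N ≤ ℓ → u ℓ = 0

/-- membership in the dual space 𝒰* -/
def memUstar (f : ℕ → ℝ) : Prop :=
  ∃ M : ℝ, ∀ u : ℕ → ℝ, u 0 = 0 → FinSupp u → |∑' ℓ, f ℓ * u ℓ| ≤ M * l2 (du u)

/-- the dual norm ‖f‖_{𝒰*} -/
def dualNorm (f : ℕ → ℝ) : ℝ :=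
  sInf {M : ℝ | 0 ≤ M ∧ ∀ u : ℕ → ℝ, u 0 = 0 → FinSupp u →
    |∑' ℓ, f ℓ * u ℓ| ≤ M * l2 (du u)}

/-- `g_ℓ = Σ_{k=ℓ+1}^∞ f_k`, as a limit of partial sums -/
def gOf (f : ℕ → ℝ) (ℓ : ℕ) : ℝ :=
  limUnder atTop (fun K : ℕ => ∑ k ∈ Finset.Ico (ℓ + 1) K, f k)

/-- duality pairing `⟨f, v⟩` for `v ∈ 𝒰`, extended by continuity (summation by parts) -/
def pairF (f : ℕ → ℝ) (v : ℕ → ℝ) : ℝ := ∑' ℓ, gOf f ℓ * du v ℓ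

/-- partial derivatives of the bulk site potential -/
def d1V (V : ℝ → ℝ → ℝ) (r s : ℝ) : ℝ := deriv (fun t => V t s) r
def d2V (V : ℝ → ℝ → ℝ) (r s : ℝ) : ℝ := deriv (fun t => V r t) s
def d11V (V : ℝ → ℝ → ℝ) (r s : ℝ) : ℝ := deriv (fun t => d1V V t s) r
def d12V (V : ℝ → ℝ → ℝ) (r s : ℝ) : ℝ := deriv (fun t => d1V V r t) s
def d22V (V : ℝ → ℝ → ℝ) (r s : ℝ) : ℝ := deriv (fun t => d2V V r t) s

/-- Cauchy–Born energy density `W(F) = V(F,F)` and its derivatives -/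
def Wcb (V : ℝ → ℝ → ℝ) (F : ℝ) : ℝ := V F F
def dW (V : ℝ → ℝ → ℝ) (F : ℝ) : ℝ := deriv (Wcb V) F
def d2W (V : ℝ → ℝ → ℝ) (F : ℝ) : ℝ := deriv (dW V) F

/-- standing assumptions (i)–(vi) on the site energies -/
structure SiteAssumptions (V : ℝ → ℝ → ℝ) (Vs : ℝ → ℝ) : Prop where
  smooth_V : ContDiff ℝ 3 (Function.uncurry V)
  smooth_Vs : ContDiff ℝ 3 Vs
  bdd_V : ∀ i : ℕ, i ≤ 3 → ∃ B : ℝ, ∀ p : ℝ × ℝ,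
    ‖iteratedFDeriv ℝ i (Function.uncurry V) p‖ ≤ B
  bdd_Vs : ∀ i : ℕ, i ≤ 3 → ∃ B : ℝ, ∀ x : ℝ, ‖iteratedFDeriv ℝ i Vs x‖ ≤ B
  V_zero : V 0 0 = 0
  posdef : ∀ p : ℝ × ℝ, p ≠ 0 →
    0 < d11V V 0 0 * p.1 ^ 2 + 2 * d12V V 0 0 * p.1 * p.2 + d22V V 0 0 * p.2 ^ 2
  pos_away : ∀ ε : ℝ, 0 < ε → ∃ δ : ℝ, 0 < δ ∧
    ∀ r s : ℝ, ε < Real.sqrt (r ^ 2 + s ^ 2) → δ ≤ V r s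
  surf_limit : ∀ s : ℝ, Tendsto (fun r => V r s) atTop (nhds (Vs s))

/-- atomistic energy, with values in `[0,∞]` (the site energies are nonnegative
under the standing assumptions) -/
def EaE (V : ℝ → ℝ → ℝ) (Vs : ℝ → ℝ) (u : ℕ → ℝ) : ℝ≥0∞ :=
  ENNReal.ofReal (Vs (du u 0)) +
    ∑' ℓ : ℕ, ENNReal.ofReal (V (du u ℓ) (du u (ℓ + 1)))

/-- ground state: global minimizer of the atomistic energy over 𝒰 -/
def GroundState (V : ℝ → ℝ → ℝ) (Vs : ℝ → ℝ) (u : ℕ → ℝ) : Prop :=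
  memU u ∧ ∀ w : ℕ → ℝ, memU w → EaE V Vs u ≤ EaE V Vs w

/-- first variation of 𝓔ᵃ, as a function of the strain sequence `e` -/
def fvA (V : ℝ → ℝ → ℝ) (Vs : ℝ → ℝ) (e : ℕ → ℝ) (v : ℕ → ℝ) : ℝ :=
  du v 0 * (deriv Vs (e 0) + d1V V (e 0) (e 1)) +
    ∑' ℓ : ℕ, du v (ℓ + 1) *
      (d2V V (e ℓ) (e (ℓ + 1)) + d1V V (e (ℓ + 1)) (e (ℓ + 2)))

/-- second variation (of 𝓔ᵃ, and of 𝓔^Γ) as a function of the strain sequence `e` -/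
def svA (V : ℝ → ℝ → ℝ) (Vs : ℝ → ℝ) (e : ℕ → ℝ) (v : ℕ → ℝ) : ℝ :=
  deriv (deriv Vs) (e 0) * (du v 0) ^ 2 +
    ∑' ℓ : ℕ, (d11V V (e ℓ) (e (ℓ + 1)) * (du v ℓ) ^ 2
      + 2 * d12V V (e ℓ) (e (ℓ + 1)) * du v ℓ * du v (ℓ + 1)
      + d22V V (e ℓ) (e (ℓ + 1)) * (du v (ℓ + 1)) ^ 2)

/-- a strongly stable ground state with stability constant `c` -/
def StronglyStableGS (V : ℝ → ℝ → ℝ) (Vs : ℝ → ℝ) (u : ℕ → ℝ) (c : ℝ) : Prop :=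
  GroundState V Vs u ∧ 0 < c ∧
    ∀ v : ℕ → ℝ, memU v → c * ∑' ℓ, (du v ℓ) ^ 2 ≤ svA V Vs (du u) v

/-- critical point of 𝓔ᵃ: the pointwise Euler–Lagrange equations -/
def CriticalA (V : ℝ → ℝ → ℝ) (Vs : ℝ → ℝ) (u : ℕ → ℝ) : Prop :=
  deriv Vs (du u 0) + d1V V (du u 0) (du u 1) = 0 ∧
  ∀ ℓ : ℕ, d2V V (du u ℓ) (du u (ℓ + 1)) + d1V V (du u (ℓ + 1)) (du u (ℓ + 2)) = 0

/-- first variation of the corrector energy 𝓔^Γ(·;F₀) -/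
def fvG (V : ℝ → ℝ → ℝ) (Vs : ℝ → ℝ) (F0 : ℝ) (q v : ℕ → ℝ) : ℝ :=
  du v 0 * (deriv Vs (F0 + du q 0) + d1V V (F0 + du q 0) (F0 + du q 1) - dW V F0) +
    ∑' ℓ : ℕ, du v (ℓ + 1) *
      (d2V V (F0 + du q ℓ) (F0 + du q (ℓ + 1))
        + d1V V (F0 + du q (ℓ + 1)) (F0 + du q (ℓ + 2)) - dW V F0)

/-- critical point of the corrector energy: pointwise Euler–Lagrange equations -/
def CriticalG (V : ℝ → ℝ → ℝ) (Vs : ℝ → ℝ) (F0 : ℝ) (q : ℕ → ℝ) : Prop :=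
  deriv Vs (F0 + du q 0) + d1V V (F0 + du q 0) (F0 + du q 1) - dW V F0 = 0 ∧
  ∀ ℓ : ℕ, d2V V (F0 + du q ℓ) (F0 + du q (ℓ + 1))
      + d1V V (F0 + du q (ℓ + 1)) (F0 + du q (ℓ + 2)) - dW V F0 = 0

/-- second variation of the corrector energy at `q` -/
def svG (V : ℝ → ℝ → ℝ) (Vs : ℝ → ℝ) (F0 : ℝ) (q v : ℕ → ℝ) : ℝ :=
  svA V Vs (fun ℓ => F0 + du q ℓ) v

/-- membership in 𝒬_L -/
def memQL (L : ℕ) (q : ℕ → ℝ) : Prop := memU q ∧ ∀ ℓ : ℕ, L ≤ ℓ → du q ℓ = 0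

/-- continuous piecewise affine interpolant of a lattice function -/
def fAff (f : ℕ → ℝ) (x : ℝ) : ℝ :=
  f ⌊x⌋₊ + (x - (⌊x⌋₊ : ℝ)) * (f (⌊x⌋₊ + 1) - f ⌊x⌋₊)

/-- `g̃(x) = ∫_x^∞ f(s) ds`, improper integral of the interpolant -/
def gTilde (f : ℕ → ℝ) (x : ℝ) : ℝ :=
  limUnder atTop (fun K : ℕ => ∫ t in x..(K : ℝ), fAff f t)

/-- the Cauchy–Born continuum energy of a strain field `w = ∇u`, valued in `[0,∞]` -/
def EcbE (V : ℝ → ℝ → ℝ) (w : ℝ → ℝ) : ℝ≥0∞ :=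
  ∫⁻ x in Set.Ioi (0 : ℝ), ENNReal.ofReal (Wcb V (w x))

/-- strain of the projection `Π_a u^cb`, given the gradient `w = ∇u^cb` -/
def PiA (w : ℝ → ℝ) (ℓ : ℕ) : ℝ := ∫ t in (ℓ : ℝ)..((ℓ : ℝ) + 1), w t

/-- the data of "the" strongly stable Cauchy–Born solution for the force `f`:
`w = ∇u^cb`, `w1 = ∇²u^cb`, `w2 = ∇³u^cb`, with constant `Cw` -/
def CBSolution (V : ℝ → ℝ → ℝ) (f : ℕ → ℝ) (Cw : ℝ) (w w1 w2 : ℝ → ℝ) : Prop :=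
  MemLp w 2 (volume.restrict (Set.Ioi 0)) ∧
  (∀ᵐ x ∂(volume.restrict (Set.Ioi (0 : ℝ))), dW V (w x) = gTilde f x) ∧
  (∃ ccb : ℝ, 0 < ccb ∧ ∀ vw : ℝ → ℝ, MemLp vw 2 (volume.restrict (Set.Ioi 0)) →
    ccb * ∫ x in Set.Ioi (0 : ℝ), (vw x) ^ 2 ≤
      ∫ x in Set.Ioi (0 : ℝ), d2W V (w x) * (vw x) ^ 2) ∧
  (∀ x ∈ Set.Ici (0 : ℝ), HasDerivAt w (w1 x) x) ∧
  (∀ᵐ x ∂(volume.restrict (Set.Ioi (0 : ℝ))), HasDerivAt w1 (w2 x) x) ∧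
  |w 0| ≤ Cw * dualNorm f

/-- A geometric decay estimate for a sequence whose squares are dissipated by a
vanishing flux that they also control. -/
lemma exists_geometric_bound_of_flux {a F : ℕ → ℝ} {c K : ℝ} (hc : 0 < c) (hK : 0 < K)
    (ha : ∀ n, 0 ≤ a n) (hF0 : Tendsto F atTop (nhds 0))
    (hF : ∀ n, F n ≤ K * a n) (hdiss : ∀ n, c * a (n + 1) ≤ F n - F (n + 1)) :
    ∃ D μ : ℝ, 0 < D ∧ 0 < μ ∧ μ < 1 ∧ ∀ n, a n ≤ D * μ ^ n := by
  have hanti : Antitone F := antitone_nat_of_succ_le fun n => by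
    nlinarith [hdiss n, mul_nonneg hc.le (ha (n + 1))]
  have hnn : ∀ n, 0 ≤ F n := fun n => hanti.le_of_tendsto hF0 n
  set μ := K / (K + c) with hμ
  have hKc : 0 < K + c := by positivity
  have hμ0 : 0 < μ := by positivity
  have hμ1 : μ < 1 := by rw [hμ, div_lt_one hKc]; linarith
  have hstep : ∀ n, F (n + 1) ≤ μ * F n := fun n => by
    rw [hμ, div_mul_eq_mul_div, le_div_iff₀ hKc]
    nlinarith [mul_le_mul_of_nonneg_left (hdiss n) hK.le,
      mul_le_mul_of_nonneg_left (hF (n + 1)) hc.le]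
  have hgeo : ∀ n, F n ≤ F 0 * μ ^ n := fun n => by
    induction n with
    | zero => simp
    | succ n ih =>
      calc F (n + 1) ≤ μ * F n := hstep n
        _ ≤ μ * (F 0 * μ ^ n) := by gcongr
        _ = F 0 * μ ^ (n + 1) := by ring
  refine ⟨a 0 + F 0 / (c * μ) + 1, μ, ?_, hμ0, hμ1, fun n => ?_⟩
  · have := ha 0
    have := hnn 0
    positivity
  · have h1 : 0 ≤ F 0 / (c * μ) := div_nonneg (hnn 0) (by positivity)
    cases n with
    | zero => simp; linarith
    | succ n =>
      have h2 : a (n + 1) ≤ F 0 / (c * μ) * μ ^ (n + 1) := by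
        have h3 : F 0 / (c * μ) * μ ^ (n + 1) = F 0 * μ ^ n / c := by
          field_simp
          ring
        rw [h3, le_div_iff₀ hc]
        linarith [hdiss n, hgeo n, hnn (n + 1)]
      nlinarith [ha 0, pow_pos hμ0 (n + 1)]

/-- An eventual geometric bound upgrades to a global one. -/
lemma exists_geometric_bound_of_shift {x : ℕ → ℝ} {D μ : ℝ} (N : ℕ) (hD : 0 < D) (hμ : 0 < μ)
    (hx : ∀ n, x (n + N) ≤ D * μ ^ n) :
    ∃ C : ℝ, 0 < C ∧ ∀ n, x n ≤ C * μ ^ n := by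
  have hsum : ∀ n, 0 ≤ |x n| / μ ^ n := fun n => by positivity
  refine ⟨D / μ ^ N + ∑ k ∈ Finset.range N, |x k| / μ ^ k, ?_, fun n => ?_⟩
  · have := Finset.sum_nonneg fun k (_ : k ∈ Finset.range N) => hsum k
    positivity
  · rcases lt_or_ge n N with hn | hn
    · have h1 := Finset.single_le_sum (fun k _ => hsum k) (Finset.mem_range.2 hn)
      calc x n ≤ |x n| := le_abs_self _
        _ = |x n| / μ ^ n * μ ^ n := by field_simp
        _ ≤ _ := by
          gcongr
          have : 0 < D / μ ^ N := by positivity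
          linarith
    · obtain ⟨m, rfl⟩ := Nat.exists_eq_add_of_le' hn
      calc x (m + N) ≤ D * μ ^ m := hx m
        _ = D / μ ^ N * μ ^ (m + N) := by rw [pow_add]; field_simp
        _ ≤ _ := by
          gcongr
          linarith [Finset.sum_nonneg fun k (_ : k ∈ Finset.range N) => hsum k]

/-- Explicit coercivity of a positive definite binary quadratic form. -/
lemma exists_coercive_of_posDef_binary {A B C : ℝ}
    (hpos : ∀ p : ℝ × ℝ, p ≠ 0 → 0 < A * p.1 ^ 2 + 2 * B * p.1 * p.2 + C * p.2 ^ 2) :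
    ∃ c : ℝ, 0 < c ∧ ∀ r s : ℝ, c * (r ^ 2 + s ^ 2) ≤ A * r ^ 2 + 2 * B * r * s + C * s ^ 2 := by
  have hA : 0 < A := by simpa using hpos (1, 0) (by simp)
  have hC : 0 < C := by simpa using hpos (0, 1) (by simp)
  have hdet : 0 < A * C - B ^ 2 := by
    have := hpos (B, -A) (by simp [hA.ne'])
    have h2 : 0 < A * (A * C - B ^ 2) := by simp only at this; linarith
    exact pos_of_mul_pos_right h2 hA.le
  refine ⟨(A * C - B ^ 2) / (A + C), by positivity, fun r s => ?_⟩
  rw [div_mul_eq_mul_div, div_le_iff₀ (by positivity)]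
  nlinarith [sq_nonneg (A * r + B * s), sq_nonneg (B * r + C * s)]

section Partials

variable {V : ℝ → ℝ → ℝ}

lemma hasDerivAt_partials {F : Type*} [NormedAddCommGroup F] [NormedSpace ℝ F]
    {g : ℝ × ℝ → F} {g' : ℝ × ℝ →L[ℝ] F} {r s : ℝ} (hg : HasFDerivAt g g' (r, s)) :
    HasDerivAt (fun t => g (t, s)) (g' (1, 0)) r ∧
      HasDerivAt (fun t => g (r, t)) (g' (0, 1)) s :=
  ⟨HasFDerivAt.comp_hasDerivAt (f := fun t : ℝ => (t, s)) r hg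
    ((hasDerivAt_id r).prodMk (hasDerivAt_const r s)),
  HasFDerivAt.comp_hasDerivAt (f := fun t : ℝ => (r, t)) s hg
    ((hasDerivAt_const s r).prodMk (hasDerivAt_id s))⟩

lemma d1V_eq_fderiv (hV : Differentiable ℝ (Function.uncurry V)) (r s : ℝ) :
    d1V V r s = fderiv ℝ (Function.uncurry V) (r, s) (1, 0) :=
  (hasDerivAt_partials (hV (r, s)).hasFDerivAt).1.deriv

lemma d2V_eq_fderiv (hV : Differentiable ℝ (Function.uncurry V)) (r s : ℝ) :
    d2V V r s = fderiv ℝ (Function.uncurry V) (r, s) (0, 1) :=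
  (hasDerivAt_partials (hV (r, s)).hasFDerivAt).2.deriv

lemma hasFDerivAt_fderiv_uncurry (hV : ContDiff ℝ 2 (Function.uncurry V)) (p : ℝ × ℝ) :
    HasFDerivAt (fderiv ℝ (Function.uncurry V))
      (fderiv ℝ (fderiv ℝ (Function.uncurry V)) p) p :=
  ((hV.fderiv_right (m := 1) (by norm_num)).differentiable (by norm_num) p).hasFDerivAt

lemma hasFDerivAt_fderiv_uncurry_apply (hV : ContDiff ℝ 2 (Function.uncurry V)) (p v : ℝ × ℝ) :
    HasFDerivAt (fun q => fderiv ℝ (Function.uncurry V) q v)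
      ((fderiv ℝ (fderiv ℝ (Function.uncurry V)) p).flip v) p :=
  (ContinuousLinearMap.apply ℝ ℝ v).hasFDerivAt.comp p (hasFDerivAt_fderiv_uncurry hV p)

lemma d11V_eq_fderiv (hV : ContDiff ℝ 2 (Function.uncurry V)) (r s : ℝ) :
    d11V V r s = fderiv ℝ (fderiv ℝ (Function.uncurry V)) (r, s) (1, 0) (1, 0) := by
  simp only [d11V, d1V_eq_fderiv (hV.differentiable (by norm_num))]
  exact (hasDerivAt_partials (hasFDerivAt_fderiv_uncurry_apply hV (r, s) (1, 0))).1.deriv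

lemma d12V_eq_fderiv (hV : ContDiff ℝ 2 (Function.uncurry V)) (r s : ℝ) :
    d12V V r s = fderiv ℝ (fderiv ℝ (Function.uncurry V)) (r, s) (0, 1) (1, 0) := by
  simp only [d12V, d1V_eq_fderiv (hV.differentiable (by norm_num))]
  exact (hasDerivAt_partials (hasFDerivAt_fderiv_uncurry_apply hV (r, s) (1, 0))).2.deriv

lemma d22V_eq_fderiv (hV : ContDiff ℝ 2 (Function.uncurry V)) (r s : ℝ) :
    d22V V r s = fderiv ℝ (fderiv ℝ (Function.uncurry V)) (r, s) (0, 1) (0, 1) := by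
  simp only [d22V, d2V_eq_fderiv (hV.differentiable (by norm_num))]
  exact (hasDerivAt_partials (hasFDerivAt_fderiv_uncurry_apply hV (r, s) (0, 1))).2.deriv

/-- First-order expansion of `∂₁V` and `∂₂V` at a critical origin. -/
lemma eventually_abs_partials_sub_le (hV : ContDiff ℝ 2 (Function.uncurry V))
    (h0 : fderiv ℝ (Function.uncurry V) 0 = 0) {ε : ℝ} (hε : 0 < ε) :
    ∀ᶠ p : ℝ × ℝ in nhds 0,
      |d1V V p.1 p.2 - (d11V V 0 0 * p.1 + d12V V 0 0 * p.2)| ≤ ε * ‖p‖ ∧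
      |d2V V p.1 p.2 - (d12V V 0 0 * p.1 + d22V V 0 0 * p.2)| ≤ ε * ‖p‖ := by
  have hsymm : IsSymmSndFDerivAt ℝ (Function.uncurry V) (0, 0) :=
    hV.contDiffAt.isSymmSndFDerivAt (by simp)
  have hd := hV.differentiable (by norm_num)
  filter_upwards [(hasFDerivAt_fderiv_uncurry hV 0).isLittleO.def hε] with p hp
  rw [h0, sub_zero, sub_zero] at hp
  have hdecomp : p = p.1 • ((1 : ℝ), (0 : ℝ)) + p.2 • ((0 : ℝ), (1 : ℝ)) := by
    ext <;> simp
  have happ : ∀ v : ℝ × ℝ, ‖v‖ ≤ 1 →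
      |fderiv ℝ (Function.uncurry V) p v -
        (p.1 * fderiv ℝ (fderiv ℝ (Function.uncurry V)) (0, 0) (1, 0) v +
          p.2 * fderiv ℝ (fderiv ℝ (Function.uncurry V)) (0, 0) (0, 1) v)| ≤ ε * ‖p‖ := by
    intro v hv
    have hlin : fderiv ℝ (fderiv ℝ (Function.uncurry V)) 0 p v =
        p.1 * fderiv ℝ (fderiv ℝ (Function.uncurry V)) (0, 0) (1, 0) v +
          p.2 * fderiv ℝ (fderiv ℝ (Function.uncurry V)) (0, 0) (0, 1) v := by
      conv_lhs => rw [hdecomp]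
      rw [map_add, map_smul, map_smul]
      rfl
    rw [← hlin]
    exact (ContinuousLinearMap.le_of_opNorm_le_of_le _ hp hv).trans_eq (mul_one _)
  constructor
  · rw [d1V_eq_fderiv hd, d11V_eq_fderiv hV, d12V_eq_fderiv hV]
    simpa only [mul_comm] using happ (1, 0) (by simp [Prod.norm_def])
  · rw [d2V_eq_fderiv hd, d22V_eq_fderiv hV, d12V_eq_fderiv hV, hsymm.eq (0, 1) (1, 0)]
    simpa only [mul_comm] using happ (0, 1) (by simp [Prod.norm_def])

end Partials

lemma SiteAssumptions.fderiv_zero {V : ℝ → ℝ → ℝ} {Vs : ℝ → ℝ} (h : SiteAssumptions V Vs) :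
    fderiv ℝ (Function.uncurry V) 0 = 0 := by
  have hmin : ∀ p : ℝ × ℝ, Function.uncurry V 0 ≤ Function.uncurry V p := by
    rintro ⟨r, s⟩
    change V 0 0 ≤ V r s
    rw [h.V_zero]
    by_cases hp : r ^ 2 + s ^ 2 = 0
    · have hr : r = 0 := by nlinarith [sq_nonneg r, sq_nonneg s]
      have hs : s = 0 := by nlinarith [sq_nonneg r, sq_nonneg s]
      rw [hr, hs, h.V_zero]
    · have hpos : 0 < Real.sqrt (r ^ 2 + s ^ 2) := Real.sqrt_pos.2 (by positivity)
      obtain ⟨δ, hδ, hle⟩ := h.pos_away _ (half_pos hpos)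
      exact hδ.le.trans (hle r s (half_lt_self hpos))
  exact IsLocalMin.fderiv_eq_zero (Eventually.of_forall hmin)

/-- Near the origin `p · ∇V(p)` is coercive and `p₂ ∂₂V(p)` is quadratically bounded. -/
lemma SiteAssumptions.exists_local_bounds {V : ℝ → ℝ → ℝ} {Vs : ℝ → ℝ}
    (h : SiteAssumptions V Vs) :
    ∃ c K : ℝ, 0 < c ∧ 0 < K ∧ ∀ᶠ p : ℝ × ℝ in nhds 0,
      c * (p.1 ^ 2 + p.2 ^ 2) ≤ p.1 * d1V V p.1 p.2 + p.2 * d2V V p.1 p.2 ∧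
      |p.2 * d2V V p.1 p.2| ≤ K * (p.1 ^ 2 + p.2 ^ 2) := by
  obtain ⟨c, hc, hcoer⟩ := exists_coercive_of_posDef_binary h.posdef
  refine ⟨c / 2, |d12V V 0 0| + |d22V V 0 0| + c / 4, by positivity, by positivity, ?_⟩
  filter_upwards [eventually_abs_partials_sub_le (h.smooth_V.of_le (by norm_num)) h.fderiv_zero
    (show 0 < c / 4 by positivity)] with p hp
  obtain ⟨h1, h2⟩ := hp
  have hr : |p.1| ≤ ‖p‖ := norm_fst_le p
  have hs : |p.2| ≤ ‖p‖ := norm_snd_le p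
  have hnorm : ‖p‖ ^ 2 ≤ p.1 ^ 2 + p.2 ^ 2 := by
    rw [Prod.norm_def]
    rcases max_choice ‖p.1‖ ‖p.2‖ with hm | hm <;> rw [hm, Real.norm_eq_abs, sq_abs] <;>
      nlinarith [sq_nonneg p.1, sq_nonneg p.2]
  set E₁ := d1V V p.1 p.2 - (d11V V 0 0 * p.1 + d12V V 0 0 * p.2) with hE₁
  set E₂ := d2V V p.1 p.2 - (d12V V 0 0 * p.1 + d22V V 0 0 * p.2) with hE₂
  have hd1 : d1V V p.1 p.2 = d11V V 0 0 * p.1 + d12V V 0 0 * p.2 + E₁ := by rw [hE₁]; ring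
  have hd2 : d2V V p.1 p.2 = d12V V 0 0 * p.1 + d22V V 0 0 * p.2 + E₂ := by rw [hE₂]; ring
  have hmul : ∀ x y b : ℝ, 0 ≤ b → |x| ≤ ‖p‖ → |y| ≤ b * ‖p‖ →
      |x * y| ≤ b * (p.1 ^ 2 + p.2 ^ 2) := fun x y b hb hx hy => by
    rw [abs_mul]
    calc |x| * |y| ≤ ‖p‖ * (b * ‖p‖) := by gcongr
      _ = b * ‖p‖ ^ 2 := by ring
      _ ≤ _ := by gcongr
  have hE1 := abs_le.1 (hmul p.1 E₁ _ (by positivity) hr h1)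
  have hE2 := hmul p.2 E₂ _ (by positivity) hs h2
  have hE2' := abs_le.1 hE2
  constructor
  · rw [hd1, hd2]
    nlinarith [hcoer p.1 p.2]
  · refine hmul _ _ _ (by positivity) hs ?_
    rw [hd2]
    calc _ ≤ |d12V V 0 0 * p.1| + |d22V V 0 0 * p.2| + |E₂| := abs_add_three _ _ _
      _ ≤ |d12V V 0 0| * ‖p‖ + |d22V V 0 0| * ‖p‖ + c / 4 * ‖p‖ := by
        rw [abs_mul, abs_mul]; gcongr
      _ = _ := by ring

/-- exponential decay of the strain of any critical point of 𝓔ᵃ. -/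
theorem exp_decay_of_critical_points (V : ℝ → ℝ → ℝ) (Vs : ℝ → ℝ)
    (h : SiteAssumptions V Vs) (u : ℕ → ℝ) (hu : memU u)
    (hcrit : CriticalA V Vs u) :
    ∃ C μ : ℝ, 0 < C ∧ 0 ≤ μ ∧ μ < 1 ∧ ∀ ℓ : ℕ, |du u ℓ| ≤ C * μ ^ ℓ := by
  obtain ⟨c, K, hc, hK, hloc⟩ := h.exists_local_bounds
  set e := du u
  have he : Tendsto e atTop (nhds 0) := by
    have := hu.2.tendsto_atTop_zero.sqrt
    simp only [Real.sqrt_sq_eq_abs, Real.sqrt_zero] at this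
    exact (tendsto_zero_iff_abs_tendsto_zero _).2 this
  have hpair : Tendsto (fun n => (e n, e (n + 1))) atTop (nhds (0 : ℝ × ℝ)) :=
    he.prodMk_nhds (he.comp (tendsto_add_atTop_nat 1))
  obtain ⟨N, hN⟩ := eventually_atTop.1 (hpair.eventually hloc)
  have hsq : Tendsto (fun n => K * (e n ^ 2 + e (n + 1) ^ 2)) atTop (nhds 0) := by
    simpa using ((he.pow 2).add ((he.comp (tendsto_add_atTop_nat 1)).pow 2)).const_mul K
  set a : ℕ → ℝ := fun n => e (n + N) ^ 2 + e (n + N + 1) ^ 2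
  set F : ℕ → ℝ := fun n => -(e (n + N + 1) * d2V V (e (n + N)) (e (n + N + 1)))
  have hFabs : ∀ n, |F n| ≤ K * a n := fun n => by
    rw [abs_neg]
    exact (hN (n + N) (Nat.le_add_left _ _)).2
  obtain ⟨D, μ, hD, hμ0, hμ1, hdecay⟩ := exists_geometric_bound_of_flux (a := a) (F := F) hc hK
    (fun n => by positivity)
    (squeeze_zero_norm hFabs (hsq.comp (tendsto_add_atTop_nat N)))
    (fun n => (le_abs_self _).trans (hFabs n))
    (fun n => by
      have h1 := (hN (n + 1 + N) (Nat.le_add_left _ _)).1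
      have h2 := hcrit.2 (n + N)
      simp only [a, F]
      rw [show n + 1 + N = n + N + 1 by ring] at h1 ⊢
      simp only at h1
      linear_combination h1 + e (n + N + 1) * h2)
  have hμs : √μ < 1 := by rwa [Real.sqrt_lt' one_pos, one_pow]
  obtain ⟨C, hC, hbound⟩ := exists_geometric_bound_of_shift (x := fun n => |e n|) N
    (Real.sqrt_pos.2 hD) (Real.sqrt_pos.2 hμ0) fun n => by
      refine abs_le_of_sq_le_sq (le_trans ?_ (hdecay n) |>.trans_eq ?_) (by positivity)
      · exact le_add_of_nonneg_right (sq_nonneg _)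
      · rw [mul_pow, Real.sq_sqrt hD.le, ← pow_mul, mul_comm n 2, pow_mul, Real.sq_sqrt hμ0.le]
  exact ⟨C, √μ, hC, Real.sqrt_nonneg _, hμs, hbound⟩
end
end

section
/- Assume a ground state u^a_gr of 𝓔ᵃ is strongly stable with constant c_a > 0. Then there exist ε > 0 and C > 0 such that for every f ∈ 𝒰* with ‖f‖_{𝒰*} < ε there exists u^a ∈ 𝒰 satisfying ⟨δ𝓔ᵃ(u^a), v⟩ = ⟨f, v⟩ for all v ∈ 𝒰, which is strongly stable (⟨δ²𝓔ᵃ(u^a)v, v⟩ ≥ c‖v'‖²_{ℓ²} for all v ∈ 𝒰, for some c > 0), locally unique, and satisfies ‖(u^a − u^a_gr)'‖_{ℓ²} ≤ C‖f‖_{𝒰*}. -/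
open scoped BigOperators ENNReal
open Filter MeasureTheory

noncomputable section

section Taylor

variable {E : Type*} [NormedAddCommGroup E] [NormedSpace ℝ E] {F : E → ℝ} {K : ℝ}

lemma norm_fderiv_fderiv_le (hK : ∀ p, ‖iteratedFDeriv ℝ 2 F p‖ ≤ K) (p : E) :
    ‖fderiv ℝ (fderiv ℝ F) p‖ ≤ K := by
  have := hK p
  rwa [← norm_iteratedFDeriv_fderiv, ← norm_iteratedFDeriv_fderiv, norm_iteratedFDeriv_zero]
    at this

set_option maxSynthPendingDepth 3 in
lemma norm_fderiv_fderiv_fderiv_le (hK : ∀ p, ‖iteratedFDeriv ℝ 3 F p‖ ≤ K) (p : E) :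
    ‖fderiv ℝ (fderiv ℝ (fderiv ℝ F)) p‖ ≤ K := by
  have := hK p
  rwa [← norm_iteratedFDeriv_fderiv, ← norm_iteratedFDeriv_fderiv,
    ← norm_iteratedFDeriv_fderiv, norm_iteratedFDeriv_zero] at this

lemma contDiff_fderiv (hF : ContDiff ℝ 3 F) : ContDiff ℝ 2 (fderiv ℝ F) :=
  hF.fderiv_right (by norm_num)

lemma contDiff_fderiv_fderiv (hF : ContDiff ℝ 3 F) : ContDiff ℝ 1 (fderiv ℝ (fderiv ℝ F)) :=
  (contDiff_fderiv hF).fderiv_right (by norm_num)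

lemma norm_fderiv_sub_le (hF : ContDiff ℝ 3 F) (hK : ∀ p, ‖iteratedFDeriv ℝ 2 F p‖ ≤ K)
    (p q : E) : ‖fderiv ℝ F p - fderiv ℝ F q‖ ≤ K * ‖p - q‖ :=
  convex_univ.norm_image_sub_le_of_norm_fderiv_le
    (fun x _ => ((contDiff_fderiv hF).differentiable (by norm_num)) x)
    (fun x _ => norm_fderiv_fderiv_le hK x) (Set.mem_univ q) (Set.mem_univ p)

set_option maxSynthPendingDepth 3 in
lemma norm_fderiv_fderiv_sub_le (hF : ContDiff ℝ 3 F)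
    (hK : ∀ p, ‖iteratedFDeriv ℝ 3 F p‖ ≤ K) (p q : E) :
    ‖fderiv ℝ (fderiv ℝ F) p - fderiv ℝ (fderiv ℝ F) q‖ ≤ K * ‖p - q‖ :=
  convex_univ.norm_image_sub_le_of_norm_fderiv_le
    (fun x _ => ((contDiff_fderiv_fderiv hF).differentiable (by norm_num)) x)
    (fun x _ => norm_fderiv_fderiv_fderiv_le hK x) (Set.mem_univ q) (Set.mem_univ p)

lemma norm_fderiv_sub_sub_le (hF : ContDiff ℝ 3 F) (hK0 : 0 ≤ K)
    (hK : ∀ p, ‖iteratedFDeriv ℝ 3 F p‖ ≤ K) {p p' q : E} {ρ : ℝ}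
    (hp : ‖p - q‖ ≤ ρ) (hp' : ‖p' - q‖ ≤ ρ) :
    ‖fderiv ℝ F p - fderiv ℝ F p' - fderiv ℝ (fderiv ℝ F) q (p - p')‖ ≤ K * ρ * ‖p - p'‖ := by
  refine (convex_closedBall q ρ).norm_image_sub_le_of_norm_fderiv_le'
    (fun x _ => ((contDiff_fderiv hF).differentiable (by norm_num)) x) (fun x hx => ?_)
    (mem_closedBall_iff_norm.2 hp') (mem_closedBall_iff_norm.2 hp)
  exact (norm_fderiv_fderiv_sub_le hF hK x q).trans
    (mul_le_mul_of_nonneg_left (mem_closedBall_iff_norm.1 hx) hK0)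

lemma norm_sub_sub_fderiv_le (hF : ContDiff ℝ 3 F) (hK0 : 0 ≤ K)
    (hK : ∀ p, ‖iteratedFDeriv ℝ 2 F p‖ ≤ K) (p w : E) :
    ‖F (p + w) - F p - fderiv ℝ F p w‖ ≤ K * ‖w‖ ^ 2 := by
  have := (convex_closedBall p ‖w‖).norm_image_sub_le_of_norm_fderiv_le' (𝕜 := ℝ) (f := F)
    (φ := fderiv ℝ F p) (C := K * ‖w‖) (x := p) (y := p + w)
    (fun x _ => (hF.differentiable (by norm_num)) x)
    (fun x hx => (norm_fderiv_sub_le hF hK x p).trans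
      (mul_le_mul_of_nonneg_left (mem_closedBall_iff_norm.1 hx) hK0))
    (by simp) (by simp)
  rw [add_sub_cancel_left] at this
  linarith

end Taylor

section Coordinates

variable {V : ℝ → ℝ → ℝ} {Vs : ℝ → ℝ}

lemma hasDerivAt_slice_left {G : ℝ × ℝ → ℝ} {r s : ℝ} (hG : DifferentiableAt ℝ G (r, s)) :
    HasDerivAt (fun t => G (t, s)) (fderiv ℝ G (r, s) (1, 0)) r :=
  hG.hasFDerivAt.comp_hasDerivAt r ((hasDerivAt_id r).prodMk (hasDerivAt_const r s))

lemma hasDerivAt_slice_right {G : ℝ × ℝ → ℝ} {r s : ℝ} (hG : DifferentiableAt ℝ G (r, s)) :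
    HasDerivAt (fun t => G (r, t)) (fderiv ℝ G (r, s) (0, 1)) s :=
  hG.hasFDerivAt.comp_hasDerivAt s ((hasDerivAt_const s r).prodMk (hasDerivAt_id s))

lemma d1V_eq (hV : ContDiff ℝ 3 (Function.uncurry V)) (r s : ℝ) :
    d1V V r s = fderiv ℝ (Function.uncurry V) (r, s) (1, 0) :=
  (hasDerivAt_slice_left (G := Function.uncurry V) (hV.differentiable (by norm_num) _)).deriv

lemma d2V_eq (hV : ContDiff ℝ 3 (Function.uncurry V)) (r s : ℝ) :
    d2V V r s = fderiv ℝ (Function.uncurry V) (r, s) (0, 1) :=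
  (hasDerivAt_slice_right (G := Function.uncurry V) (hV.differentiable (by norm_num) _)).deriv

lemma hasFDerivAt_fderiv_apply {E : Type*} [NormedAddCommGroup E] [NormedSpace ℝ E] {F : E → ℝ}
    (hF : ContDiff ℝ 3 F) (p w : E) :
    HasFDerivAt (fun q => fderiv ℝ F q w) ((fderiv ℝ (fderiv ℝ F) p).flip w) p := by
  have h := ((contDiff_fderiv hF).differentiable (by norm_num) p).hasFDerivAt.clm_apply
    (hasFDerivAt_const w p)
  simpa using h

lemma d11V_eq (hV : ContDiff ℝ 3 (Function.uncurry V)) (r s : ℝ) :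
    d11V V r s = fderiv ℝ (fderiv ℝ (Function.uncurry V)) (r, s) (1, 0) (1, 0) := by
  have h := hasFDerivAt_fderiv_apply hV (r, s) (1, 0)
  have := (hasDerivAt_slice_left h.differentiableAt).deriv
  simpa [d11V, funext fun t => d1V_eq hV t s, h.fderiv] using this

lemma d12V_eq (hV : ContDiff ℝ 3 (Function.uncurry V)) (r s : ℝ) :
    d12V V r s = fderiv ℝ (fderiv ℝ (Function.uncurry V)) (r, s) (0, 1) (1, 0) := by
  have h := hasFDerivAt_fderiv_apply hV (r, s) (1, 0)
  have := (hasDerivAt_slice_right h.differentiableAt).deriv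
  simpa [d12V, funext fun t => d1V_eq hV r t, h.fderiv] using this

lemma d22V_eq (hV : ContDiff ℝ 3 (Function.uncurry V)) (r s : ℝ) :
    d22V V r s = fderiv ℝ (fderiv ℝ (Function.uncurry V)) (r, s) (0, 1) (0, 1) := by
  have h := hasFDerivAt_fderiv_apply hV (r, s) (0, 1)
  have := (hasDerivAt_slice_right h.differentiableAt).deriv
  simpa [d22V, funext fun t => d2V_eq hV r t, h.fderiv] using this

/-- the Hessian quadratic form of the bulk site potential -/
def hessV (V : ℝ → ℝ → ℝ) (r s a b : ℝ) : ℝ :=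
  d11V V r s * a ^ 2 + 2 * d12V V r s * a * b + d22V V r s * b ^ 2

lemma fderiv_apply_eq (hV : ContDiff ℝ 3 (Function.uncurry V)) (r s a b : ℝ) :
    fderiv ℝ (Function.uncurry V) (r, s) (a, b) = d1V V r s * a + d2V V r s * b := by
  have : ((a, b) : ℝ × ℝ) = a • (1, 0) + b • (0, 1) := by simp
  rw [this, map_add, map_smul, map_smul, d1V_eq hV, d2V_eq hV]
  simp only [smul_eq_mul]
  ring

lemma fderiv_fderiv_apply_eq (hV : ContDiff ℝ 3 (Function.uncurry V)) (r s a b : ℝ) :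
    fderiv ℝ (fderiv ℝ (Function.uncurry V)) (r, s) (a, b) (a, b) = hessV V r s a b := by
  have hsymm : fderiv ℝ (fderiv ℝ (Function.uncurry V)) (r, s) (1, 0) (0, 1)
      = fderiv ℝ (fderiv ℝ (Function.uncurry V)) (r, s) (0, 1) (1, 0) :=
    hV.contDiffAt.isSymmSndFDerivAt (by simp; norm_num) _ _
  have : ((a, b) : ℝ × ℝ) = a • (1, 0) + b • (0, 1) := by simp
  rw [this, hessV, d11V_eq hV, d12V_eq hV, d22V_eq hV]
  simp only [map_add, map_smul, add_apply, smul_apply,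
    smul_eq_mul, hsymm]
  ring

lemma deriv_deriv_eq (hVs : ContDiff ℝ 3 Vs) (x : ℝ) :
    deriv (deriv Vs) x = fderiv ℝ (fderiv ℝ Vs) x 1 1 := by
  have h := hasFDerivAt_fderiv_apply hVs x 1
  have := h.hasDerivAt.deriv
  simpa using this

lemma fderiv_real_apply (x a : ℝ) : fderiv ℝ Vs x a = deriv Vs x * a := by
  simp [mul_comm]

lemma fderiv_fderiv_real_apply (hVs : ContDiff ℝ 3 Vs) (x a b : ℝ) :
    fderiv ℝ (fderiv ℝ Vs) x a b = deriv (deriv Vs) x * a * b := by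
  have := map_smul (fderiv ℝ (fderiv ℝ Vs) x) a 1
  have := map_smul (fderiv ℝ (fderiv ℝ Vs) x a) b 1
  simp_all only [smul_eq_mul, mul_one, deriv_deriv_eq hVs, smul_apply]
  ring

lemma norm_mk_sq_le (a b : ℝ) : ‖((a, b) : ℝ × ℝ)‖ ^ 2 ≤ a ^ 2 + b ^ 2 := by
  rw [Prod.norm_mk]
  rcases max_choice ‖a‖ ‖b‖ with h | h <;> rw [h, Real.norm_eq_abs, sq_abs] <;>
    nlinarith [sq_nonneg a, sq_nonneg b]

lemma norm_mk_le (a b : ℝ) : ‖((a, b) : ℝ × ℝ)‖ ≤ |a| + |b| := by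
  rw [Prod.norm_mk]
  exact max_le (by simp) (by simp)

end Coordinates

/-- uniform Lipschitz and Taylor estimates for the site potentials, with one constant `K` -/
structure SiteBounds (V : ℝ → ℝ → ℝ) (Vs : ℝ → ℝ) (K : ℝ) : Prop where
  pos : 0 < K
  lip_d1V : ∀ r s r' s', |d1V V r s - d1V V r' s'| ≤ K * (|r - r'| + |s - s'|)
  lip_d2V : ∀ r s r' s', |d2V V r s - d2V V r' s'| ≤ K * (|r - r'| + |s - s'|)
  lip_Vs : ∀ x y, |deriv Vs x - deriv Vs y| ≤ K * |x - y|
  taylor_V : ∀ r s a b,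
    |V (r + a) (s + b) - V r s - (d1V V r s * a + d2V V r s * b)| ≤ K * (a ^ 2 + b ^ 2)
  taylor_Vs : ∀ x a, |Vs (x + a) - Vs x - deriv Vs x * a| ≤ K * a ^ 2
  grad_V : ∀ ρ r₀ s₀ r s r' s', |r - r₀| ≤ ρ → |s - s₀| ≤ ρ → |r' - r₀| ≤ ρ → |s' - s₀| ≤ ρ →
    |(d1V V r s - d1V V r' s') * (r - r') + (d2V V r s - d2V V r' s') * (s - s')
      - hessV V r₀ s₀ (r - r') (s - s')| ≤ K * ρ * ((r - r') ^ 2 + (s - s') ^ 2)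
  grad_Vs : ∀ ρ x₀ x x', |x - x₀| ≤ ρ → |x' - x₀| ≤ ρ →
    |(deriv Vs x - deriv Vs x') * (x - x') - deriv (deriv Vs) x₀ * (x - x') ^ 2|
      ≤ K * ρ * (x - x') ^ 2
  hess_le : ∀ r s a b, |hessV V r s a b| ≤ K * (a ^ 2 + b ^ 2)
  hess_V : ∀ ρ r₀ s₀ r s a b, |r - r₀| ≤ ρ → |s - s₀| ≤ ρ →
    |hessV V r s a b - hessV V r₀ s₀ a b| ≤ K * ρ * (a ^ 2 + b ^ 2)
  hess_Vs : ∀ ρ x₀ x a, |x - x₀| ≤ ρ →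
    |deriv (deriv Vs) x * a ^ 2 - deriv (deriv Vs) x₀ * a ^ 2| ≤ K * ρ * a ^ 2

lemma SiteAssumptions.exists_siteBounds {V : ℝ → ℝ → ℝ} {Vs : ℝ → ℝ}
    (h : SiteAssumptions V Vs) : ∃ K, SiteBounds V Vs K := by
  obtain ⟨B2, hB2⟩ := h.bdd_V 2 (by norm_num)
  obtain ⟨B3, hB3⟩ := h.bdd_V 3 (by norm_num)
  obtain ⟨C2, hC2⟩ := h.bdd_Vs 2 (by norm_num)
  obtain ⟨C3, hC3⟩ := h.bdd_Vs 3 (by norm_num)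
  obtain ⟨K, hK⟩ : ∃ K, K = |B2| + |B3| + |C2| + |C3| + 1 := ⟨_, rfl⟩
  have a1 := abs_nonneg B2
  have a2 := abs_nonneg B3
  have a3 := abs_nonneg C2
  have a4 := abs_nonneg C3
  have hK0 : 0 < K := by linarith
  have hV2 : ∀ p, ‖iteratedFDeriv ℝ 2 (Function.uncurry V) p‖ ≤ K := fun p =>
    (hB2 p).trans (by linarith [le_abs_self B2])
  have hV3 : ∀ p, ‖iteratedFDeriv ℝ 3 (Function.uncurry V) p‖ ≤ K := fun p =>
    (hB3 p).trans (by linarith [le_abs_self B3])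
  have hs2 : ∀ p, ‖iteratedFDeriv ℝ 2 Vs p‖ ≤ K := fun p =>
    (hC2 p).trans (by linarith [le_abs_self C2])
  have hs3 : ∀ p, ‖iteratedFDeriv ℝ 3 Vs p‖ ≤ K := fun p =>
    (hC3 p).trans (by linarith [le_abs_self C3])
  have sV := h.smooth_V
  have sVs := h.smooth_Vs
  have hlip : ∀ r s r' s' : ℝ, ∀ w : ℝ × ℝ, ‖w‖ = 1 →
      |fderiv ℝ (Function.uncurry V) (r, s) w - fderiv ℝ (Function.uncurry V) (r', s') w|
        ≤ K * (|r - r'| + |s - s'|) := by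
    intro r s r' s' w hw
    have h1 := (fderiv ℝ (Function.uncurry V) (r, s)
      - fderiv ℝ (Function.uncurry V) (r', s')).le_opNorm w
    rw [hw, mul_one, sub_apply, Real.norm_eq_abs] at h1
    refine (h1.trans (norm_fderiv_sub_le sV hV2 _ _)).trans ?_
    exact mul_le_mul_of_nonneg_left (norm_mk_le _ _) hK0.le
  refine ⟨K, hK0, ?_, ?_, ?_, ?_, ?_, ?_, ?_, ?_, ?_, ?_⟩
  · intro r s r' s'
    rw [d1V_eq sV, d1V_eq sV]
    exact hlip _ _ _ _ _ (by simp [Prod.norm_mk])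
  · intro r s r' s'
    rw [d2V_eq sV, d2V_eq sV]
    exact hlip _ _ _ _ _ (by simp [Prod.norm_mk])
  · intro x y
    have h1 := (fderiv ℝ Vs x - fderiv ℝ Vs y).le_opNorm 1
    rw [norm_one, mul_one, sub_apply, Real.norm_eq_abs, fderiv_real_apply,
      fderiv_real_apply, mul_one, mul_one] at h1
    exact h1.trans (norm_fderiv_sub_le sVs hs2 _ _)
  · intro r s a b
    have := norm_sub_sub_fderiv_le sV hK0.le hV2 (r, s) (a, b)
    rw [fderiv_apply_eq sV, Real.norm_eq_abs] at this
    exact this.trans (mul_le_mul_of_nonneg_left (norm_mk_sq_le a b) hK0.le)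
  · intro x a
    have := norm_sub_sub_fderiv_le sVs hK0.le hs2 x a
    rwa [fderiv_real_apply, Real.norm_eq_abs, Real.norm_eq_abs, sq_abs] at this
  · intro ρ r₀ s₀ r s r' s' h1 h2 h3 h4
    have hρ : 0 ≤ ρ := (abs_nonneg _).trans h1
    have hd := norm_fderiv_sub_sub_le sV hK0.le hV3 (p := (r, s)) (p' := (r', s'))
      (q := (r₀, s₀)) (ρ := ρ) (max_le h1 h2) (max_le h3 h4)
    have := ContinuousLinearMap.le_of_opNorm_le _ hd ((r, s) - (r', s'))
    simp only [Prod.mk_sub_mk, sub_apply, fderiv_fderiv_apply_eq sV,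
      fderiv_apply_eq sV, Real.norm_eq_abs] at this
    calc _ = _ := by ring_nf
      _ ≤ _ := this
      _ = K * ρ * ‖((r - r', s - s') : ℝ × ℝ)‖ ^ 2 := by ring
      _ ≤ _ := mul_le_mul_of_nonneg_left (norm_mk_sq_le _ _) (by positivity)
  · intro ρ x₀ x x' h1 h2
    have hd := norm_fderiv_sub_sub_le sVs hK0.le hs3 (p := x) (p' := x') (q := x₀) (ρ := ρ) h1 h2
    have := ContinuousLinearMap.le_of_opNorm_le _ hd (x - x')
    simp only [sub_apply, fderiv_fderiv_real_apply sVs,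
      fderiv_real_apply, Real.norm_eq_abs] at this
    calc _ = _ := by ring_nf
      _ ≤ _ := this
      _ = K * ρ * |x - x'| ^ 2 := by ring
      _ = _ := by rw [sq_abs]
  · intro r s a b
    have := ContinuousLinearMap.le_of_opNorm_le _
      (ContinuousLinearMap.le_of_opNorm_le _ (norm_fderiv_fderiv_le hV2 (r, s)) (a, b)) (a, b)
    rw [fderiv_fderiv_apply_eq sV, Real.norm_eq_abs] at this
    calc _ ≤ _ := this
      _ = K * ‖((a, b) : ℝ × ℝ)‖ ^ 2 := by ring
      _ ≤ _ := mul_le_mul_of_nonneg_left (norm_mk_sq_le _ _) hK0.le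
  · intro ρ r₀ s₀ r s a b h1 h2
    have hρ : 0 ≤ ρ := (abs_nonneg _).trans h1
    have hd := norm_fderiv_fderiv_sub_le sV hV3 (r, s) (r₀, s₀)
    have hd' := hd.trans (mul_le_mul_of_nonneg_left (max_le h1 h2 : _ ≤ ρ) hK0.le)
    have := ContinuousLinearMap.le_of_opNorm_le _
      (ContinuousLinearMap.le_of_opNorm_le _ hd' (a, b)) (a, b)
    simp only [sub_apply, fderiv_fderiv_apply_eq sV, Real.norm_eq_abs] at this
    calc _ ≤ _ := this
      _ = K * ρ * ‖((a, b) : ℝ × ℝ)‖ ^ 2 := by ring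
      _ ≤ _ := mul_le_mul_of_nonneg_left (norm_mk_sq_le _ _) (by positivity)
  · intro ρ x₀ x a h1
    have hd := norm_fderiv_fderiv_sub_le sVs hs3 x x₀
    have hd' := hd.trans (mul_le_mul_of_nonneg_left (h1 : _ ≤ ρ) hK0.le)
    have := ContinuousLinearMap.le_of_opNorm_le _
      (ContinuousLinearMap.le_of_opNorm_le _ hd' a) a
    simp only [sub_apply, fderiv_fderiv_real_apply sVs,
      Real.norm_eq_abs] at this
    calc _ = _ := by ring_nf
      _ ≤ _ := this
      _ = K * ρ * |a| ^ 2 := by ring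
      _ = _ := by rw [sq_abs]

section DualRepresentation

lemma du_sum_range (e : ℕ → ℝ) : du (fun n => ∑ i ∈ Finset.range n, e i) = e := by
  funext ℓ
  simp [du, Finset.sum_range_succ]

/-- partial sums `f_1 + ⋯ + f_ℓ` of a force -/
def partialForce (f : ℕ → ℝ) (ℓ : ℕ) : ℝ := ∑ k ∈ Finset.range ℓ, f (k + 1)

lemma sum_mul_add_sum_partialForce_mul_du {f u : ℕ → ℝ} (hu : u 0 = 0) (n : ℕ) :
    ∑ ℓ ∈ Finset.range (n + 1), f ℓ * u ℓ + ∑ ℓ ∈ Finset.range n, partialForce f ℓ * du u ℓ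
      = partialForce f n * u n := by
  induction n with
  | zero => simp [hu]
  | succ n ih =>
    rw [Finset.sum_range_succ, Finset.sum_range_succ (fun ℓ => partialForce f ℓ * du u ℓ)]
    have : partialForce f (n + 1) = partialForce f n + f (n + 1) := by
      simp [partialForce, Finset.sum_range_succ]
    rw [this, du]
    linarith

variable {f : ℕ → ℝ} {M : ℝ}

lemma abs_sum_partialForce_mul_le
    (hM : ∀ u : ℕ → ℝ, u 0 = 0 → FinSupp u → |∑' ℓ, f ℓ * u ℓ| ≤ M * l2 (du u))
    {e : ℕ → ℝ} {N : ℕ} (he : ∀ ℓ, N ≤ ℓ → e ℓ = 0) (hsum : ∑ ℓ ∈ Finset.range N, e ℓ = 0) :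
    |∑ ℓ ∈ Finset.range N, partialForce f ℓ * e ℓ|
      ≤ M * √(∑ ℓ ∈ Finset.range N, e ℓ ^ 2) := by
  set u : ℕ → ℝ := fun n => ∑ i ∈ Finset.range n, e i with hu
  have hdu : du u = e := du_sum_range e
  have hu0 : u 0 = 0 := by simp [hu]
  have hsupp : ∀ n, N ≤ n → u n = 0 := fun n hn => by
    rw [hu, ← hsum]
    exact Finset.eventually_constant_sum he hn
  have h := hM u hu0 ⟨N, hsupp⟩
  have hparts := sum_mul_add_sum_partialForce_mul_du (f := f) hu0 N
  rw [hsupp N le_rfl, mul_zero, hdu] at hparts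
  rw [tsum_eq_sum (s := Finset.range (N + 1)), eq_neg_of_add_eq_zero_left hparts, abs_neg, hdu,
    l2, tsum_eq_sum (s := Finset.range N)] at h
  · exact h
  · intro ℓ hℓ
    rw [he ℓ (by simpa using hℓ)]
    simp
  · intro ℓ hℓ
    rw [hsupp ℓ (by simp at hℓ; omega), mul_zero]

lemma sum_sq_partialForce_sub_mean_le
    (hM : ∀ u : ℕ → ℝ, u 0 = 0 → FinSupp u → |∑' ℓ, f ℓ * u ℓ| ≤ M * l2 (du u))
    {N : ℕ} (hN : N ≠ 0) :
    ∑ ℓ ∈ Finset.range N,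
      (partialForce f ℓ - (∑ k ∈ Finset.range N, partialForce f k) / N) ^ 2 ≤ M ^ 2 := by
  set c := (∑ k ∈ Finset.range N, partialForce f k) / N with hc
  set e : ℕ → ℝ := fun ℓ => if ℓ < N then partialForce f ℓ - c else 0 with he
  have heN : ∀ ℓ ∈ Finset.range N, e ℓ = partialForce f ℓ - c := fun ℓ hℓ => by
    simp [he, Finset.mem_range.1 hℓ]
  have hN' : (N : ℝ) ≠ 0 := by exact_mod_cast hN
  have hsum : ∑ ℓ ∈ Finset.range N, e ℓ = 0 := by
    rw [Finset.sum_congr rfl heN, Finset.sum_sub_distrib, Finset.sum_const, Finset.card_range,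
      nsmul_eq_mul, hc, mul_div_cancel₀ _ hN', sub_self]
  have hQ : ∑ ℓ ∈ Finset.range N, partialForce f ℓ * e ℓ = ∑ ℓ ∈ Finset.range N, e ℓ ^ 2 := by
    have : ∑ ℓ ∈ Finset.range N, e ℓ ^ 2
        = ∑ ℓ ∈ Finset.range N, (partialForce f ℓ * e ℓ - c * e ℓ) :=
      Finset.sum_congr rfl fun ℓ hℓ => by rw [heN ℓ hℓ]; ring
    rw [this, Finset.sum_sub_distrib, ← Finset.mul_sum, hsum, mul_zero, sub_zero]
  have h := abs_sum_partialForce_mul_le hM (e := e) (N := N)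
    (fun ℓ hℓ => by simp [he, not_lt.2 hℓ]) hsum
  have hQ' : ∑ ℓ ∈ Finset.range N, (partialForce f ℓ - c) ^ 2
      = ∑ ℓ ∈ Finset.range N, e ℓ ^ 2 :=
    Finset.sum_congr rfl fun ℓ hℓ => by rw [heN ℓ hℓ]
  rw [hQ']
  have hQ0 : 0 ≤ ∑ ℓ ∈ Finset.range N, e ℓ ^ 2 := Finset.sum_nonneg fun _ _ => sq_nonneg _
  rw [hQ, abs_of_nonneg hQ0] at h
  have hs := Real.sq_sqrt hQ0
  have hs0 := Real.sqrt_nonneg (∑ ℓ ∈ Finset.range N, e ℓ ^ 2)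
  nlinarith [sq_nonneg (√(∑ ℓ ∈ Finset.range N, e ℓ ^ 2) - M)]

lemma exists_sum_sq_partialForce_sub_le (hM0 : 0 ≤ M)
    (hM : ∀ u : ℕ → ℝ, u 0 = 0 → FinSupp u → |∑' ℓ, f ℓ * u ℓ| ≤ M * l2 (du u)) :
    ∃ c, ∀ n, ∑ ℓ ∈ Finset.range n, (partialForce f ℓ - c) ^ 2 ≤ M ^ 2 := by
  set c : ℕ → ℝ := fun N =>
    (∑ k ∈ Finset.range (N + 1), partialForce f k) / ((N + 1 : ℕ) : ℝ) with hc
  have hcM : ∀ N, ∑ ℓ ∈ Finset.range (N + 1), (partialForce f ℓ - c N) ^ 2 ≤ M ^ 2 := fun N =>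
    sum_sq_partialForce_sub_mean_le hM N.succ_ne_zero
  have hmem : ∀ N, c N ∈ Set.Icc (-M) M := by
    intro N
    have h0 := (Finset.single_le_sum (f := fun ℓ => (partialForce f ℓ - c N) ^ 2)
      (fun _ _ => sq_nonneg _) (Finset.mem_range.2 N.succ_pos)).trans (hcM N)
    simp only [partialForce, Finset.range_zero, Finset.sum_empty, zero_sub, neg_sq] at h0
    exact abs_le.1 (abs_le_of_sq_le_sq h0 hM0)
  obtain ⟨a, -, φ, hφ, hlim⟩ := isCompact_Icc.tendsto_subseq hmem
  refine ⟨a, fun n => ?_⟩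
  refine le_of_tendsto (x := atTop)
    (f := fun k => ∑ ℓ ∈ Finset.range n, (partialForce f ℓ - c (φ k)) ^ 2)
    (tendsto_finsetSum _ fun ℓ _ => (tendsto_const_nhds.sub hlim).pow 2) ?_
  filter_upwards [eventually_ge_atTop n] with k hk
  refine (Finset.sum_le_sum_of_subset_of_nonneg ?_ fun _ _ _ => sq_nonneg _).trans (hcM (φ k))
  exact Finset.range_mono (by have := hφ.id_le k; simp only [id] at this; omega)

lemma gOf_sq_summable_and_le (hM0 : 0 ≤ M)
    (hM : ∀ u : ℕ → ℝ, u 0 = 0 → FinSupp u → |∑' ℓ, f ℓ * u ℓ| ≤ M * l2 (du u)) :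
    Summable (fun ℓ => gOf f ℓ ^ 2) ∧ ∑' ℓ, gOf f ℓ ^ 2 ≤ M ^ 2 := by
  obtain ⟨c, hc⟩ := exists_sum_sq_partialForce_sub_le hM0 hM
  have hs : Summable fun ℓ => (partialForce f ℓ - c) ^ 2 :=
    summable_of_sum_range_le (fun _ => sq_nonneg _) hc
  have h0 : Tendsto (fun ℓ => partialForce f ℓ - c) atTop (nhds 0) := by
    have := (Real.continuous_sqrt.tendsto 0).comp hs.tendsto_atTop_zero
    rw [tendsto_zero_iff_abs_tendsto_zero]
    simpa [Function.comp_def, Real.sqrt_sq_eq_abs] using this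
  have hlim : Tendsto (partialForce f) atTop (nhds c) := by
    simpa using h0.add_const c
  have hg : ∀ ℓ, gOf f ℓ = c - partialForce f ℓ := by
    intro ℓ
    refine Tendsto.limUnder_eq ((tendsto_add_atTop_iff_nat 1).1 ?_)
    refine (hlim.sub_const (partialForce f ℓ)).congr' ?_
    filter_upwards [eventually_ge_atTop ℓ] with j hj
    rw [← Finset.sum_Ico_add', Finset.sum_Ico_eq_sub _ hj]
    rfl
  have hsq : (fun ℓ => gOf f ℓ ^ 2) = fun ℓ => (partialForce f ℓ - c) ^ 2 := by
    funext ℓ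
    rw [hg]
    ring
  rw [hsq]
  exact ⟨hs, hs.tsum_le_of_sum_range_le hc⟩

lemma gOf_sq_summable (hf : memUstar f) : Summable (fun ℓ => gOf f ℓ ^ 2) := by
  obtain ⟨M, hM⟩ := hf
  exact (gOf_sq_summable_and_le (abs_nonneg M) fun u h0 hu => (hM u h0 hu).trans
    (mul_le_mul_of_nonneg_right (le_abs_self M) (Real.sqrt_nonneg _))).1

lemma l2_gOf_le_dualNorm (hf : memUstar f) : l2 (gOf f) ≤ dualNorm f := by
  obtain ⟨M, hM⟩ := hf
  refine le_csInf ⟨|M|, abs_nonneg M, fun u h0 hu => (hM u h0 hu).trans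
    (mul_le_mul_of_nonneg_right (le_abs_self M) (Real.sqrt_nonneg _))⟩ ?_
  rintro B ⟨hB0, hB⟩
  exact Real.sqrt_le_iff.2 ⟨hB0, (gOf_sq_summable_and_le hB0 hB).2⟩

end DualRepresentation

lemma exists_eq_of_strongly_monotone {H : Type*} [NormedAddCommGroup H] [InnerProductSpace ℝ H]
    [CompleteSpace H] {T : H → H} {x₀ : H} {m L r : ℝ} (hm : 0 < m) (hmL : m ≤ L) (hr : 0 < r)
    (hmono : ∀ x ∈ Metric.closedBall x₀ r, ∀ y ∈ Metric.closedBall x₀ r,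
      m * ‖x - y‖ ^ 2 ≤ inner ℝ (T x - T y) (x - y))
    (hlip : ∀ x y, ‖T x - T y‖ ≤ L * ‖x - y‖) {g : H} (hg : ‖g - T x₀‖ ≤ m * r / 2) :
    ∃ x ∈ Metric.closedBall x₀ r, T x = g := by
  have hL : 0 < L := hm.trans_le hmL
  obtain ⟨q, hq⟩ : ∃ q, q = 1 - m ^ 2 / L ^ 2 / 2 := ⟨_, rfl⟩
  have hmin0 : 0 < m ^ 2 / L ^ 2 := by positivity
  have hmin1 : m ^ 2 / L ^ 2 ≤ 1 := div_le_one_of_le₀ (by gcongr) (by positivity)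
  have hq0 : 0 ≤ q := by linarith
  have hq1 : q < 1 := by linarith
  obtain ⟨τ, hτ⟩ : ∃ τ, τ = m / L ^ 2 := ⟨_, rfl⟩
  have hτ0 : 0 < τ := by rw [hτ]; positivity
  have hτL : τ * L ^ 2 = m := by rw [hτ]; field_simp
  have hτm : τ * m = m ^ 2 / L ^ 2 := by rw [hτ]; ring
  set Φ : H → H := fun x => x - τ • (T x - g) with hΦ
  have hcontr : ∀ x ∈ Metric.closedBall x₀ r, ∀ y ∈ Metric.closedBall x₀ r,
      ‖Φ x - Φ y‖ ≤ q * ‖x - y‖ := by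
    intro x hx y hy
    have e1 : Φ x - Φ y = (x - y) - τ • (T x - T y) := by
      simp only [hΦ, smul_sub]; abel
    have e2 : ‖Φ x - Φ y‖ ^ 2 = ‖x - y‖ ^ 2 - 2 * (τ * inner ℝ (T x - T y) (x - y))
        + τ ^ 2 * ‖T x - T y‖ ^ 2 := by
      rw [e1, norm_sub_sq_real, inner_smul_right, real_inner_comm, norm_smul, mul_pow,
        Real.norm_eq_abs, sq_abs]
    have h1 := hmono x hx y hy
    have h2 : ‖T x - T y‖ ^ 2 ≤ L ^ 2 * ‖x - y‖ ^ 2 := by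
      rw [← mul_pow]; exact pow_le_pow_left₀ (norm_nonneg _) (hlip x y) 2
    have h3 : ‖Φ x - Φ y‖ ^ 2 ≤ (1 - τ * m) * ‖x - y‖ ^ 2 := by
      have h4 := mul_le_mul_of_nonneg_left h1 hτ0.le
      have h5 := mul_le_mul_of_nonneg_left h2 (sq_nonneg τ)
      have h6 : τ ^ 2 * (L ^ 2 * ‖x - y‖ ^ 2) = τ * m * ‖x - y‖ ^ 2 := by
        rw [← hτL]; ring
      nlinarith
    refine abs_le_of_sq_le_sq' ?_ (by positivity) |>.2
    rw [mul_pow]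
    refine h3.trans (mul_le_mul_of_nonneg_right ?_ (sq_nonneg _))
    rw [hτm, hq]
    nlinarith [sq_nonneg (m ^ 2 / L ^ 2)]
  have hx₀ : x₀ ∈ Metric.closedBall x₀ r := Metric.mem_closedBall_self hr.le
  have hmaps : Set.MapsTo Φ (Metric.closedBall x₀ r) (Metric.closedBall x₀ r) := by
    intro x hx
    rw [mem_closedBall_iff_norm]
    have h1 := hcontr x hx x₀ hx₀
    have h2 : ‖Φ x₀ - x₀‖ ≤ τ * (m * r / 2) := by
      have : Φ x₀ - x₀ = τ • (g - T x₀) := by simp only [hΦ, smul_sub]; abel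
      rw [this, norm_smul, Real.norm_of_nonneg hτ0.le]
      exact mul_le_mul_of_nonneg_left hg hτ0.le
    have h3 : q * ‖x - x₀‖ ≤ q * r :=
      mul_le_mul_of_nonneg_left (mem_closedBall_iff_norm.1 hx) hq0
    have h4 : τ * (m * r / 2) = (1 - q) * r := by rw [hq, ← hτm]; ring
    have h5 := norm_add_le (Φ x - Φ x₀) (Φ x₀ - x₀)
    rw [sub_add_sub_cancel] at h5
    linarith
  have hK : ContractingWith ⟨q, hq0⟩ (hmaps.restrict Φ _ _) := by
    refine ⟨by exact_mod_cast hq1, LipschitzWith.of_dist_le_mul fun x y => ?_⟩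
    rw [Subtype.dist_eq, Subtype.dist_eq, dist_eq_norm, dist_eq_norm]
    exact hcontr x x.2 y y.2
  obtain ⟨x, hx, hfix, -⟩ := hK.exists_fixedPoint' Metric.isClosed_closedBall.isComplete hmaps
    hx₀ (edist_ne_top _ _)
  refine ⟨x, hx, ?_⟩
  have : τ • (T x - g) = 0 := by
    have : x - τ • (T x - g) = x := hfix
    simpa using this
  exact sub_eq_zero.1 ((smul_eq_zero.1 this).resolve_left hτ0.ne')

section SquareSummable

lemma summable_mul_of_summable_sq {e g : ℕ → ℝ} (he : Summable fun ℓ => e ℓ ^ 2)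
    (hg : Summable fun ℓ => g ℓ ^ 2) : Summable fun ℓ => e ℓ * g ℓ := by
  refine Summable.of_norm_bounded (he.add hg) fun ℓ => ?_
  rw [Real.norm_eq_abs, abs_le]
  constructor <;> nlinarith [sq_nonneg (e ℓ + g ℓ), sq_nonneg (e ℓ - g ℓ), sq_nonneg (e ℓ),
    sq_nonneg (g ℓ)]

lemma summable_sq_succ {e : ℕ → ℝ} (he : Summable fun ℓ => e ℓ ^ 2) :
    Summable fun ℓ => e (ℓ + 1) ^ 2 :=
  (summable_nat_add_iff (f := fun ℓ => e ℓ ^ 2) 1).2 he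

lemma summable_sq_sub {e g : ℕ → ℝ} (he : Summable fun ℓ => e ℓ ^ 2)
    (hg : Summable fun ℓ => g ℓ ^ 2) : Summable fun ℓ => (e ℓ - g ℓ) ^ 2 := by
  refine Summable.of_nonneg_of_le (fun _ => sq_nonneg _) (fun ℓ => ?_)
    ((he.mul_left 2).add (hg.mul_left 2))
  nlinarith [sq_nonneg (e ℓ + g ℓ)]

lemma summable_sq_add {e g : ℕ → ℝ} (he : Summable fun ℓ => e ℓ ^ 2)
    (hg : Summable fun ℓ => g ℓ ^ 2) : Summable fun ℓ => (e ℓ + g ℓ) ^ 2 := by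
  refine Summable.of_nonneg_of_le (fun _ => sq_nonneg _) (fun ℓ => ?_)
    ((he.mul_left 2).add (hg.mul_left 2))
  nlinarith [sq_nonneg (e ℓ - g ℓ)]

lemma sq_add_tsum_sq_succ {e : ℕ → ℝ} (he : Summable fun ℓ => e ℓ ^ 2) :
    e 0 ^ 2 + ∑' ℓ, e (ℓ + 1) ^ 2 = ∑' ℓ, e ℓ ^ 2 :=
  he.tsum_eq_zero_add.symm

lemma summable_and_abs_add_tsum_le {A s : ℝ} {a w : ℕ → ℝ} (hA : 0 ≤ A)
    (hw : Summable fun ℓ => w ℓ ^ 2) (hs : |s| ≤ A * w 0 ^ 2)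
    (ha : ∀ ℓ, |a ℓ| ≤ A * (w ℓ ^ 2 + w (ℓ + 1) ^ 2)) :
    Summable a ∧ |s + ∑' ℓ, a ℓ| ≤ 3 * A * ∑' ℓ, w ℓ ^ 2 := by
  have hw' := summable_sq_succ hw
  have hb : Summable fun ℓ => A * (w ℓ ^ 2 + w (ℓ + 1) ^ 2) := (hw.add hw').mul_left A
  have ha' : Summable a := Summable.of_norm_bounded hb ha
  refine ⟨ha', ?_⟩
  have h1 : |∑' ℓ, a ℓ| ≤ ∑' ℓ, A * (w ℓ ^ 2 + w (ℓ + 1) ^ 2) :=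
    tsum_of_norm_bounded (f := a) hb.hasSum ha
  rw [tsum_mul_left, hw.tsum_add hw'] at h1
  have h2 := sq_add_tsum_sq_succ hw
  have h3 : 0 ≤ ∑' ℓ, w (ℓ + 1) ^ 2 := tsum_nonneg fun _ => sq_nonneg _
  have h4 := abs_add_le s (∑' ℓ, a ℓ)
  nlinarith [mul_nonneg hA h3, mul_nonneg hA (sq_nonneg (w 0))]

/-- the Hilbert space of square-summable strain sequences -/
abbrev StrainSpace := lp (fun _ : ℕ => ℝ) 2

lemma memℓp_two_iff {e : ℕ → ℝ} : Memℓp e 2 ↔ Summable fun ℓ => e ℓ ^ 2 := by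
  rw [memℓp_gen_iff (by norm_num)]
  simp

lemma StrainSpace.summable_sq (x : StrainSpace) : Summable fun ℓ => x ℓ ^ 2 :=
  memℓp_two_iff.1 (lp.memℓp x)

lemma StrainSpace.inner_eq (x y : StrainSpace) : inner ℝ x y = ∑' ℓ, x ℓ * y ℓ := by
  rw [lp.inner_eq_tsum]
  simp [mul_comm]

lemma StrainSpace.norm_sq (x : StrainSpace) : ‖x‖ ^ 2 = ∑' ℓ, x ℓ ^ 2 := by
  rw [← real_inner_self_eq_norm_sq, StrainSpace.inner_eq]
  simp [sq]

lemma StrainSpace.norm_eq_l2 (x : StrainSpace) : ‖x‖ = l2 x := by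
  rw [l2, ← StrainSpace.norm_sq, Real.sqrt_sq (norm_nonneg _)]

lemma StrainSpace.abs_apply_le (x : StrainSpace) (ℓ : ℕ) : |x ℓ| ≤ ‖x‖ :=
  lp.norm_apply_le_norm (by norm_num) x ℓ

end SquareSummable

section Residual

variable {V : ℝ → ℝ → ℝ} {Vs : ℝ → ℝ} {K : ℝ}

/-- strain-wise residual of the atomistic energy: the Riesz representative of its first
variation -/
def forceResidual (V : ℝ → ℝ → ℝ) (Vs : ℝ → ℝ) (e : ℕ → ℝ) : ℕ → ℝ
  | 0 => deriv Vs (e 0) + d1V V (e 0) (e 1)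
  | ℓ + 1 => d2V V (e ℓ) (e (ℓ + 1)) + d1V V (e (ℓ + 1)) (e (ℓ + 2))

/-- second variation evaluated at a test strain -/
def hessForm (V : ℝ → ℝ → ℝ) (Vs : ℝ → ℝ) (e w : ℕ → ℝ) : ℝ :=
  deriv (deriv Vs) (e 0) * w 0 ^ 2 + ∑' ℓ, hessV V (e ℓ) (e (ℓ + 1)) (w ℓ) (w (ℓ + 1))

lemma svA_eq_hessForm (e v : ℕ → ℝ) : svA V Vs e v = hessForm V Vs e (du v) := rfl

lemma SiteBounds.residual_sub_sq_le (hK : SiteBounds V Vs K) (e g : ℕ → ℝ) (ℓ : ℕ) :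
    (forceResidual V Vs e ℓ - forceResidual V Vs g ℓ) ^ 2 ≤ 8 * K ^ 2 *
      ((e (ℓ - 1) - g (ℓ - 1)) ^ 2 + (e ℓ - g ℓ) ^ 2 + (e (ℓ + 1) - g (ℓ + 1)) ^ 2) := by
  have hK0 := hK.pos
  cases ℓ with
  | zero =>
    have h1 := hK.lip_Vs (e 0) (g 0)
    have h2 := hK.lip_d1V (e 0) (e 1) (g 0) (g 1)
    have h3 : |forceResidual V Vs e 0 - forceResidual V Vs g 0|
        ≤ K * (2 * |e 0 - g 0| + |e 1 - g 1|) := by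
      have := abs_add_le (deriv Vs (e 0) - deriv Vs (g 0)) (d1V V (e 0) (e 1) - d1V V (g 0) (g 1))
      simp only [forceResidual, add_sub_add_comm]
      linarith
    have h4 := pow_le_pow_left₀ (abs_nonneg _) h3 2
    rw [sq_abs, mul_pow] at h4
    refine h4.trans ?_
    rw [mul_comm 8, mul_assoc]
    refine mul_le_mul_of_nonneg_left ?_ (sq_nonneg K)
    simp only [zero_add, Nat.zero_sub]
    rw [← sq_abs (e 0 - g 0), ← sq_abs (e 1 - g 1)]
    nlinarith [sq_nonneg (2 * |e 0 - g 0| - |e 1 - g 1|), sq_nonneg |e 1 - g 1|]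
  | succ ℓ =>
    have h1 := hK.lip_d2V (e ℓ) (e (ℓ + 1)) (g ℓ) (g (ℓ + 1))
    have h2 := hK.lip_d1V (e (ℓ + 1)) (e (ℓ + 2)) (g (ℓ + 1)) (g (ℓ + 2))
    have h3 : |forceResidual V Vs e (ℓ + 1) - forceResidual V Vs g (ℓ + 1)|
        ≤ K * (|e ℓ - g ℓ| + 2 * |e (ℓ + 1) - g (ℓ + 1)| + |e (ℓ + 2) - g (ℓ + 2)|) := by
      have := abs_add_le (d2V V (e ℓ) (e (ℓ + 1)) - d2V V (g ℓ) (g (ℓ + 1)))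
        (d1V V (e (ℓ + 1)) (e (ℓ + 2)) - d1V V (g (ℓ + 1)) (g (ℓ + 2)))
      simp only [forceResidual, add_sub_add_comm]
      linarith
    have h4 := pow_le_pow_left₀ (abs_nonneg _) h3 2
    rw [sq_abs, mul_pow] at h4
    refine h4.trans ?_
    rw [mul_comm 8, mul_assoc]
    refine mul_le_mul_of_nonneg_left ?_ (sq_nonneg K)
    simp only [Nat.add_sub_cancel, add_assoc, Nat.reduceAdd]
    rw [← sq_abs (e ℓ - g ℓ), ← sq_abs (e (ℓ + 1) - g (ℓ + 1)),
      ← sq_abs (e (ℓ + 2) - g (ℓ + 2))]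
    generalize |e ℓ - g ℓ| = x, |e (ℓ + 1) - g (ℓ + 1)| = y, |e (ℓ + 2) - g (ℓ + 2)| = z
    nlinarith [sq_nonneg (x - y), sq_nonneg (y - z), sq_nonneg (x - z)]

lemma SiteBounds.summable_residual_sub_sq (hK : SiteBounds V Vs K) {e g : ℕ → ℝ}
    (hd : Summable fun ℓ => (e ℓ - g ℓ) ^ 2) :
    Summable (fun ℓ => (forceResidual V Vs e ℓ - forceResidual V Vs g ℓ) ^ 2) ∧
      ∑' ℓ, (forceResidual V Vs e ℓ - forceResidual V Vs g ℓ) ^ 2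
        ≤ (6 * K) ^ 2 * ∑' ℓ, (e ℓ - g ℓ) ^ 2 := by
  have hd1 : Summable fun ℓ => (e (ℓ - 1) - g (ℓ - 1)) ^ 2 :=
    (summable_nat_add_iff (f := fun ℓ => (e (ℓ - 1) - g (ℓ - 1)) ^ 2) 1).1 (by simpa using hd)
  have hd2 : Summable fun ℓ => (e (ℓ + 1) - g (ℓ + 1)) ^ 2 :=
    summable_sq_succ (e := fun ℓ => e ℓ - g ℓ) hd
  have hb := ((hd1.add hd).add hd2).mul_left (8 * K ^ 2)
  have hs := Summable.of_nonneg_of_le (fun _ => sq_nonneg _) (hK.residual_sub_sq_le e g) hb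
  refine ⟨hs, (hs.tsum_le_tsum (hK.residual_sub_sq_le e g) hb).trans ?_⟩
  rw [tsum_mul_left, (hd1.add hd).tsum_add hd2, hd1.tsum_add hd, hd1.tsum_eq_zero_add]
  have h2 := sq_add_tsum_sq_succ (e := fun ℓ => e ℓ - g ℓ) hd
  simp only [Nat.add_sub_cancel, Nat.zero_sub]
  have h3 : 0 ≤ ∑' ℓ, (e (ℓ + 1) - g (ℓ + 1)) ^ 2 := tsum_nonneg fun _ => sq_nonneg _
  have h0 := sq_nonneg (e 0 - g 0)
  have h5 : (e 0 - g 0) ^ 2 + ∑' ℓ, (e ℓ - g ℓ) ^ 2 + ∑' ℓ, (e ℓ - g ℓ) ^ 2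
      + ∑' ℓ, (e (ℓ + 1) - g (ℓ + 1)) ^ 2 ≤ 4 * ∑' ℓ, (e ℓ - g ℓ) ^ 2 := by linarith
  have h6 : 0 ≤ ∑' ℓ, (e ℓ - g ℓ) ^ 2 := tsum_nonneg fun _ => sq_nonneg _
  nlinarith [mul_le_mul_of_nonneg_left h5 (sq_nonneg K), mul_nonneg (sq_nonneg K) h6]

lemma SiteBounds.summable_residual_sq (hK : SiteBounds V Vs K) (h1 : d1V V 0 0 = 0)
    (h2 : d2V V 0 0 = 0) {e : ℕ → ℝ} (he : Summable fun ℓ => e ℓ ^ 2) :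
    Summable fun ℓ => forceResidual V Vs e ℓ ^ 2 := by
  have hd := (hK.summable_residual_sub_sq (e := e) (g := fun _ => 0) (by simpa using he)).1
  have h0 : Summable fun ℓ => forceResidual V Vs (fun _ => 0) ℓ ^ 2 :=
    (summable_nat_add_iff 1).1 (by simp [forceResidual, h1, h2])
  simpa using summable_sq_add hd h0

lemma SiteBounds.summable_d1V_sq (hK : SiteBounds V Vs K) (h1 : d1V V 0 0 = 0) {e : ℕ → ℝ}
    (he : Summable fun ℓ => e ℓ ^ 2) : Summable fun ℓ => d1V V (e ℓ) (e (ℓ + 1)) ^ 2 := by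
  refine Summable.of_nonneg_of_le (fun _ => sq_nonneg _) (fun ℓ => ?_)
    ((he.add (summable_sq_succ he)).mul_left (2 * K ^ 2))
  have h := pow_le_pow_left₀ (abs_nonneg _) (hK.lip_d1V (e ℓ) (e (ℓ + 1)) 0 0) 2
  rw [h1, sub_zero, sub_zero, sub_zero, sq_abs, mul_pow] at h
  have h' : (|e ℓ| + |e (ℓ + 1)|) ^ 2 ≤ 2 * (e ℓ ^ 2 + e (ℓ + 1) ^ 2) := by
    rw [← sq_abs (e ℓ), ← sq_abs (e (ℓ + 1))]
    nlinarith [sq_nonneg (|e ℓ| - |e (ℓ + 1)|)]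
  nlinarith [mul_le_mul_of_nonneg_left h' (sq_nonneg K)]

lemma SiteBounds.summable_d2V_sq (hK : SiteBounds V Vs K) (h2 : d2V V 0 0 = 0) {e : ℕ → ℝ}
    (he : Summable fun ℓ => e ℓ ^ 2) : Summable fun ℓ => d2V V (e ℓ) (e (ℓ + 1)) ^ 2 := by
  refine Summable.of_nonneg_of_le (fun _ => sq_nonneg _) (fun ℓ => ?_)
    ((he.add (summable_sq_succ he)).mul_left (2 * K ^ 2))
  have h := pow_le_pow_left₀ (abs_nonneg _) (hK.lip_d2V (e ℓ) (e (ℓ + 1)) 0 0) 2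
  rw [h2, sub_zero, sub_zero, sub_zero, sq_abs, mul_pow] at h
  have h' : (|e ℓ| + |e (ℓ + 1)|) ^ 2 ≤ 2 * (e ℓ ^ 2 + e (ℓ + 1) ^ 2) := by
    rw [← sq_abs (e ℓ), ← sq_abs (e (ℓ + 1))]
    nlinarith [sq_nonneg (|e ℓ| - |e (ℓ + 1)|)]
  nlinarith [mul_le_mul_of_nonneg_left h' (sq_nonneg K)]

lemma SiteBounds.fvA_eq_tsum (hK : SiteBounds V Vs K) (h1 : d1V V 0 0 = 0)
    (h2 : d2V V 0 0 = 0) {e v : ℕ → ℝ} (he : Summable fun ℓ => e ℓ ^ 2)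
    (hv : Summable fun ℓ => du v ℓ ^ 2) :
    fvA V Vs e v = ∑' ℓ, forceResidual V Vs e ℓ * du v ℓ := by
  rw [(summable_mul_of_summable_sq (hK.summable_residual_sq h1 h2 he) hv).tsum_eq_zero_add]
  simp only [fvA, forceResidual, mul_comm]

lemma SiteBounds.tsum_residual_mul (hK : SiteBounds V Vs K) (h1 : d1V V 0 0 = 0)
    (h2 : d2V V 0 0 = 0) {e w : ℕ → ℝ} (he : Summable fun ℓ => e ℓ ^ 2)
    (hw : Summable fun ℓ => w ℓ ^ 2) :
    Summable (fun ℓ => d1V V (e ℓ) (e (ℓ + 1)) * w ℓ + d2V V (e ℓ) (e (ℓ + 1)) * w (ℓ + 1)) ∧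
    ∑' ℓ, forceResidual V Vs e ℓ * w ℓ = deriv Vs (e 0) * w 0 +
      ∑' ℓ, (d1V V (e ℓ) (e (ℓ + 1)) * w ℓ + d2V V (e ℓ) (e (ℓ + 1)) * w (ℓ + 1)) := by
  have s1 := summable_mul_of_summable_sq (hK.summable_d1V_sq h1 he) hw
  have s2 := summable_mul_of_summable_sq (hK.summable_d2V_sq h2 he) (summable_sq_succ hw)
  refine ⟨s1.add s2, ?_⟩
  have s1' : Summable fun ℓ => d1V V (e (ℓ + 1)) (e (ℓ + 1 + 1)) * w (ℓ + 1) :=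
    (summable_nat_add_iff (f := fun ℓ => d1V V (e ℓ) (e (ℓ + 1)) * w ℓ) 1).2 s1
  rw [(summable_mul_of_summable_sq (hK.summable_residual_sq h1 h2 he) hw).tsum_eq_zero_add,
    s1.tsum_add s2, s1.tsum_eq_zero_add]
  simp only [forceResidual, add_mul]
  rw [s2.tsum_add s1']
  ring

lemma SiteBounds.summable_hessV (hK : SiteBounds V Vs K) (e : ℕ → ℝ) {w : ℕ → ℝ}
    (hw : Summable fun ℓ => w ℓ ^ 2) :
    Summable fun ℓ => hessV V (e ℓ) (e (ℓ + 1)) (w ℓ) (w (ℓ + 1)) :=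
  Summable.of_norm_bounded ((hw.add (summable_sq_succ hw)).mul_left K) fun _ => hK.hess_le _ _ _ _

lemma SiteBounds.abs_hessForm_sub_le (hK : SiteBounds V Vs K) {ρ : ℝ} {e e₀ w : ℕ → ℝ}
    (hw : Summable fun ℓ => w ℓ ^ 2) (he : ∀ ℓ, |e ℓ - e₀ ℓ| ≤ ρ) :
    |hessForm V Vs e w - hessForm V Vs e₀ w| ≤ 3 * (K * ρ) * ∑' ℓ, w ℓ ^ 2 := by
  have hρ : 0 ≤ ρ := (abs_nonneg _).trans (he 0)
  have h := (summable_and_abs_add_tsum_le (mul_nonneg hK.pos.le hρ) hw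
    (hK.hess_Vs ρ _ _ (w 0) (he 0))
    (fun ℓ => hK.hess_V ρ _ _ _ _ (w ℓ) (w (ℓ + 1)) (he ℓ) (he (ℓ + 1)))).2
  rw [(hK.summable_hessV e hw).tsum_sub (hK.summable_hessV e₀ hw)] at h
  simpa only [hessForm, add_sub_add_comm] using h

lemma SiteBounds.abs_residual_sub_mul_sub_hessForm_le (hK : SiteBounds V Vs K)
    (h1 : d1V V 0 0 = 0) (h2 : d2V V 0 0 = 0) {ρ : ℝ} {e g e₀ : ℕ → ℝ}
    (hes : Summable fun ℓ => e ℓ ^ 2) (hgs : Summable fun ℓ => g ℓ ^ 2)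
    (he : ∀ ℓ, |e ℓ - e₀ ℓ| ≤ ρ) (hg : ∀ ℓ, |g ℓ - e₀ ℓ| ≤ ρ) :
    |∑' ℓ, (forceResidual V Vs e ℓ - forceResidual V Vs g ℓ) * (e ℓ - g ℓ)
      - hessForm V Vs e₀ (fun ℓ => e ℓ - g ℓ)| ≤ 3 * (K * ρ) * ∑' ℓ, (e ℓ - g ℓ) ^ 2 := by
  have hρ : 0 ≤ ρ := (abs_nonneg _).trans (he 0)
  have hw := summable_sq_sub hes hgs
  have h := (summable_and_abs_add_tsum_le (w := fun ℓ => e ℓ - g ℓ)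
    (mul_nonneg hK.pos.le hρ) hw (hK.grad_Vs ρ _ _ _ (he 0) (hg 0))
    (fun ℓ => hK.grad_V ρ _ _ _ _ _ _ (he ℓ) (he (ℓ + 1)) (hg ℓ) (hg (ℓ + 1)))).2
  obtain ⟨se, te⟩ := hK.tsum_residual_mul h1 h2 hes hw
  obtain ⟨sg, tg⟩ := hK.tsum_residual_mul h1 h2 hgs hw
  have seg : ∀ ℓ, (d1V V (e ℓ) (e (ℓ + 1)) - d1V V (g ℓ) (g (ℓ + 1))) * (e ℓ - g ℓ)
      + (d2V V (e ℓ) (e (ℓ + 1)) - d2V V (g ℓ) (g (ℓ + 1))) * (e (ℓ + 1) - g (ℓ + 1))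
      = (d1V V (e ℓ) (e (ℓ + 1)) * (e ℓ - g ℓ)
          + d2V V (e ℓ) (e (ℓ + 1)) * (e (ℓ + 1) - g (ℓ + 1)))
        - (d1V V (g ℓ) (g (ℓ + 1)) * (e ℓ - g ℓ)
          + d2V V (g ℓ) (g (ℓ + 1)) * (e (ℓ + 1) - g (ℓ + 1))) := fun ℓ => by ring
  simp only [seg] at h
  rw [(se.sub sg).tsum_sub (hK.summable_hessV e₀ hw), se.tsum_sub sg] at h
  have ht : ∑' ℓ, (forceResidual V Vs e ℓ - forceResidual V Vs g ℓ) * (e ℓ - g ℓ)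
      = ∑' ℓ, forceResidual V Vs e ℓ * (e ℓ - g ℓ) - ∑' ℓ, forceResidual V Vs g ℓ * (e ℓ - g ℓ) := by
    simp only [sub_mul]
    exact (summable_mul_of_summable_sq (hK.summable_residual_sq h1 h2 hes) hw).tsum_sub
      (summable_mul_of_summable_sq (hK.summable_residual_sq h1 h2 hgs) hw)
  rw [ht, te, tg, hessForm]
  refine le_of_eq_of_le ?_ h
  congr 1
  ring

end Residual

section Energy

variable {V : ℝ → ℝ → ℝ} {Vs : ℝ → ℝ} {K : ℝ}

lemma SiteAssumptions.V_nonneg (h : SiteAssumptions V Vs) (r s : ℝ) : 0 ≤ V r s := by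
  by_cases h0 : r = 0 ∧ s = 0
  · rw [h0.1, h0.2, h.V_zero]
  · have hpos : 0 < √(r ^ 2 + s ^ 2) := by
      refine Real.sqrt_pos.2 ?_
      rcases not_and_or.1 h0 with hr | hs <;> positivity
    obtain ⟨δ, hδ, hV⟩ := h.pos_away (√(r ^ 2 + s ^ 2) / 2) (by positivity)
    exact hδ.le.trans (hV r s (by linarith))

lemma SiteAssumptions.Vs_nonneg (h : SiteAssumptions V Vs) (s : ℝ) : 0 ≤ Vs s :=
  ge_of_tendsto' (h.surf_limit s) fun r => h.V_nonneg r s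

lemma SiteAssumptions.d1V_zero (h : SiteAssumptions V Vs) : d1V V 0 0 = 0 :=
  IsLocalMin.deriv_eq_zero (Eventually.of_forall fun t => by
    simpa only [h.V_zero] using h.V_nonneg t 0)

lemma SiteAssumptions.d2V_zero (h : SiteAssumptions V Vs) : d2V V 0 0 = 0 :=
  IsLocalMin.deriv_eq_zero (Eventually.of_forall fun t => by
    simpa only [h.V_zero] using h.V_nonneg 0 t)

/-- the atomistic energy as a real number, meaningful for square-summable strains -/
def realEnergy (V : ℝ → ℝ → ℝ) (Vs : ℝ → ℝ) (e : ℕ → ℝ) : ℝ :=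
  Vs (e 0) + ∑' ℓ, V (e ℓ) (e (ℓ + 1))

lemma SiteAssumptions.summable_V (h : SiteAssumptions V Vs) (hK : SiteBounds V Vs K) {e : ℕ → ℝ}
    (he : Summable fun ℓ => e ℓ ^ 2) : Summable fun ℓ => V (e ℓ) (e (ℓ + 1)) := by
  refine Summable.of_norm_bounded ((he.add (summable_sq_succ he)).mul_left K) fun ℓ => ?_
  simpa [h.V_zero, h.d1V_zero, h.d2V_zero] using hK.taylor_V 0 0 (e ℓ) (e (ℓ + 1))

lemma SiteAssumptions.EaE_eq_ofReal (h : SiteAssumptions V Vs) (hK : SiteBounds V Vs K)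
    {u : ℕ → ℝ} (hu : memU u) : EaE V Vs u = ENNReal.ofReal (realEnergy V Vs (du u)) := by
  rw [realEnergy, ENNReal.ofReal_add (h.Vs_nonneg _) (tsum_nonneg fun _ => h.V_nonneg _ _),
    ENNReal.ofReal_tsum_of_nonneg (fun _ => h.V_nonneg _ _) (h.summable_V hK hu.2), EaE]

lemma GroundState.realEnergy_le (h : SiteAssumptions V Vs) (hK : SiteBounds V Vs K) {u : ℕ → ℝ}
    (hu : GroundState V Vs u) {e : ℕ → ℝ} (he : Summable fun ℓ => e ℓ ^ 2) :
    realEnergy V Vs (du u) ≤ realEnergy V Vs e := by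
  have hw : memU (fun n => ∑ i ∈ Finset.range n, e i) :=
    ⟨by simp, by rw [du_sum_range]; exact he⟩
  have := hu.2 _ hw
  rw [h.EaE_eq_ofReal hK hu.1, h.EaE_eq_ofReal hK hw, du_sum_range] at this
  exact (ENNReal.ofReal_le_ofReal_iff
    (add_nonneg (h.Vs_nonneg _) (tsum_nonneg fun _ => h.V_nonneg _ _))).1 this

lemma SiteAssumptions.realEnergy_add_sub_le (h : SiteAssumptions V Vs) (hK : SiteBounds V Vs K)
    {e w : ℕ → ℝ} (he : Summable fun ℓ => e ℓ ^ 2) (hw : Summable fun ℓ => w ℓ ^ 2) :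
    realEnergy V Vs (fun ℓ => e ℓ + w ℓ) - realEnergy V Vs e
      ≤ ∑' ℓ, forceResidual V Vs e ℓ * w ℓ + 3 * K * ∑' ℓ, w ℓ ^ 2 := by
  have hb := (summable_and_abs_add_tsum_le hK.pos.le hw (hK.taylor_Vs (e 0) (w 0))
    (fun ℓ => hK.taylor_V (e ℓ) (e (ℓ + 1)) (w ℓ) (w (ℓ + 1)))).2
  obtain ⟨sr, tr⟩ := hK.tsum_residual_mul h.d1V_zero h.d2V_zero he hw
  have s1 := h.summable_V hK (summable_sq_add he hw)
  have s0 := h.summable_V hK he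
  rw [(s1.sub s0).tsum_sub sr, s1.tsum_sub s0] at hb
  have := (abs_le.1 hb).2
  rw [tr, realEnergy, realEnergy]
  linarith

lemma GroundState.residual_eq_zero (h : SiteAssumptions V Vs) (hK : SiteBounds V Vs K) {u : ℕ → ℝ}
    (hu : GroundState V Vs u) (ℓ : ℕ) : forceResidual V Vs (du u) ℓ = 0 := by
  have hK0 := hK.pos
  have hs := hK.summable_residual_sq h.d1V_zero h.d2V_zero hu.1.2
  obtain ⟨τ, hτ⟩ : ∃ τ, τ = 1 / (6 * K) := ⟨_, rfl⟩
  have hτ0 : 0 < τ := by rw [hτ]; positivity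
  have hw : Summable fun ℓ => (-τ * forceResidual V Vs (du u) ℓ) ^ 2 := by
    simpa only [mul_pow] using hs.mul_left ((-τ) ^ 2)
  have h1 := h.realEnergy_add_sub_le hK hu.1.2 hw
  have h2 := hu.realEnergy_le h hK (summable_sq_add hu.1.2 hw)
  have h3 : ∑' ℓ, forceResidual V Vs (du u) ℓ * (-τ * forceResidual V Vs (du u) ℓ)
      = -τ * ∑' ℓ, forceResidual V Vs (du u) ℓ ^ 2 := by
    rw [← tsum_mul_left]
    exact tsum_congr fun ℓ => by ring
  have h4 : ∑' ℓ, (-τ * forceResidual V Vs (du u) ℓ) ^ 2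
      = τ ^ 2 * ∑' ℓ, forceResidual V Vs (du u) ℓ ^ 2 := by
    rw [← tsum_mul_left]
    exact tsum_congr fun ℓ => by ring
  rw [h3, h4] at h1
  have h5 : 3 * K * τ = 1 / 2 := by rw [hτ]; field_simp; norm_num
  have h6 : 3 * K * (τ ^ 2 * ∑' ℓ, forceResidual V Vs (du u) ℓ ^ 2)
      = 1 / 2 * τ * ∑' ℓ, forceResidual V Vs (du u) ℓ ^ 2 := by rw [← h5]; ring
  have h7 : forceResidual V Vs (du u) ℓ ^ 2 ≤ ∑' ℓ, forceResidual V Vs (du u) ℓ ^ 2 :=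
    hs.le_tsum ℓ fun _ _ => sq_nonneg _
  have h8 : ∑' ℓ, forceResidual V Vs (du u) ℓ ^ 2 ≤ 0 := by
    by_contra! hcon
    nlinarith [mul_pos hτ0 hcon]
  exact pow_eq_zero_iff two_ne_zero |>.1 (le_antisymm (h7.trans h8) (sq_nonneg _))

end Energy

section ResidualOperator

variable {V : ℝ → ℝ → ℝ} {Vs : ℝ → ℝ} {K : ℝ}

/-- the residual as an operator on the Hilbert space of strains -/
def residualOp (h : SiteAssumptions V Vs) (hK : SiteBounds V Vs K) (x : StrainSpace) :
    StrainSpace :=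
  ⟨forceResidual V Vs x,
    memℓp_two_iff.2 (hK.summable_residual_sq h.d1V_zero h.d2V_zero (StrainSpace.summable_sq x))⟩

lemma residualOp_apply (h : SiteAssumptions V Vs) (hK : SiteBounds V Vs K) (x : StrainSpace)
    (ℓ : ℕ) : residualOp h hK x ℓ = forceResidual V Vs x ℓ := rfl

lemma norm_residualOp_sub_le (h : SiteAssumptions V Vs) (hK : SiteBounds V Vs K)
    (x y : StrainSpace) : ‖residualOp h hK x - residualOp h hK y‖ ≤ 6 * K * ‖x - y‖ := by
  have hK0 := hK.pos
  have hb := (hK.summable_residual_sub_sq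
    (summable_sq_sub (StrainSpace.summable_sq x) (StrainSpace.summable_sq y))).2
  refine abs_le_of_sq_le_sq' ?_ (by positivity) |>.2
  rw [mul_pow, StrainSpace.norm_sq, StrainSpace.norm_sq]
  exact hb

lemma le_inner_residualOp_sub (h : SiteAssumptions V Vs) (hK : SiteBounds V Vs K)
    {x₀ x y : StrainSpace} {ρ : ℝ} (hx : ‖x - x₀‖ ≤ ρ) (hy : ‖y - x₀‖ ≤ ρ) :
    hessForm V Vs x₀ (x - y : StrainSpace) - 3 * (K * ρ) * ‖x - y‖ ^ 2
      ≤ inner ℝ (residualOp h hK x - residualOp h hK y) (x - y) := by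
  have hb := (abs_le.1 (hK.abs_residual_sub_mul_sub_hessForm_le h.d1V_zero h.d2V_zero
    (StrainSpace.summable_sq x) (StrainSpace.summable_sq y) (e₀ := x₀)
    (fun ℓ => (StrainSpace.abs_apply_le (x - x₀) ℓ).trans hx)
    (fun ℓ => (StrainSpace.abs_apply_le (y - x₀) ℓ).trans hy))).1
  rw [StrainSpace.inner_eq, StrainSpace.norm_sq]
  simp only [lp.coeFn_sub, Pi.sub_apply, residualOp_apply]
  have : (⇑x - ⇑y) = fun ℓ => x ℓ - y ℓ := rfl
  rw [this]
  linarith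

lemma fvA_eq_inner (h : SiteAssumptions V Vs) (hK : SiteBounds V Vs K) (x w : StrainSpace)
    {v : ℕ → ℝ} (hv : du v = w) : fvA V Vs x v = inner ℝ (residualOp h hK x) w := by
  rw [hK.fvA_eq_tsum h.d1V_zero h.d2V_zero (StrainSpace.summable_sq x)
      (by rw [hv]; exact StrainSpace.summable_sq w), hv,
    StrainSpace.inner_eq]
  rfl

end ResidualOperator

/-- the strain of an admissible displacement as an element of the Hilbert space of strains -/
def memU.strain {u : ℕ → ℝ} (hu : memU u) : StrainSpace := ⟨du u, memℓp_two_iff.2 hu.2⟩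

lemma memU.coe_strain {u : ℕ → ℝ} (hu : memU u) : (hu.strain : ℕ → ℝ) = du u := rfl

lemma memU_sum_range (x : StrainSpace) : memU (fun n => ∑ i ∈ Finset.range n, x i) :=
  ⟨by simp, by rw [du_sum_range]; exact StrainSpace.summable_sq x⟩

lemma eq_sum_range_du {u : ℕ → ℝ} (hu : u 0 = 0) (n : ℕ) :
    u n = ∑ i ∈ Finset.range n, du u i := by
  simp only [du, Finset.sum_range_sub, hu, sub_zero]

/-- existence of unique, strongly stable atomistic solutions for
small external forces, near a strongly stable ground state. -/
theorem atomistic_solutions_for_small_forces (V : ℝ → ℝ → ℝ) (Vs : ℝ → ℝ)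
    (h : SiteAssumptions V Vs) (ugr : ℕ → ℝ) (ca : ℝ)
    (hgs : StronglyStableGS V Vs ugr ca) :
    ∃ ε C : ℝ, 0 < ε ∧ 0 < C ∧ ∀ f : ℕ → ℝ, memUstar f → dualNorm f < ε →
      ∃ ua : ℕ → ℝ, memU ua ∧
        (∀ v : ℕ → ℝ, memU v → fvA V Vs (du ua) v = pairF f v) ∧
        (∃ c : ℝ, 0 < c ∧ ∀ v : ℕ → ℝ, memU v →
          c * ∑' ℓ, (du v ℓ) ^ 2 ≤ svA V Vs (du ua) v) ∧
        (∃ r : ℝ, 0 < r ∧ ∀ u' : ℕ → ℝ, memU u' →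
          l2 (fun ℓ => du u' ℓ - du ua ℓ) < r →
          (∀ v : ℕ → ℝ, memU v → fvA V Vs (du u') v = pairF f v) →
          ∀ ℓ, u' ℓ = ua ℓ) ∧
        l2 (fun ℓ => du ua ℓ - du ugr ℓ) ≤ C * dualNorm f := by
  obtain ⟨K, hK⟩ := h.exists_siteBounds
  obtain ⟨hground, hca, hstab⟩ := hgs
  have hK0 := hK.pos
  set x₀ : StrainSpace := hground.1.strain with hx₀
  obtain ⟨m, hm⟩ : ∃ m, m = ca / 2 := ⟨_, rfl⟩
  obtain ⟨r, hr⟩ : ∃ r, r = ca / (6 * K) := ⟨_, rfl⟩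
  have hm0 : 0 < m := by rw [hm]; positivity
  have hr0 : 0 < r := by rw [hr]; positivity
  have hKr : 3 * (K * r) = m := by rw [hr, hm]; field_simp; norm_num
  have hstab' : ∀ w : StrainSpace, ca * ‖w‖ ^ 2 ≤ hessForm V Vs x₀ w := by
    intro w
    have := hstab _ (memU_sum_range w)
    rwa [svA_eq_hessForm, du_sum_range, ← StrainSpace.norm_sq] at this
  have hmono : ∀ x ∈ Metric.closedBall x₀ r, ∀ y ∈ Metric.closedBall x₀ r,
      m * ‖x - y‖ ^ 2 ≤ inner ℝ (residualOp h hK x - residualOp h hK y) (x - y) := by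
    intro x hx y hy
    have h1 := le_inner_residualOp_sub h hK (mem_closedBall_iff_norm.1 hx)
      (mem_closedBall_iff_norm.1 hy)
    rw [hKr] at h1
    have h2 := hstab' (x - y)
    have h3 : ca * ‖x - y‖ ^ 2 = m * ‖x - y‖ ^ 2 + m * ‖x - y‖ ^ 2 := by rw [hm]; ring
    linarith
  have hT₀ : residualOp h hK x₀ = 0 := by
    ext ℓ
    exact hground.residual_eq_zero h hK ℓ
  have hlip : ∀ x y, ‖residualOp h hK x - residualOp h hK y‖ ≤ max (6 * K) m * ‖x - y‖ :=
    fun x y => (norm_residualOp_sub_le h hK x y).trans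
      (mul_le_mul_of_nonneg_right (le_max_left _ _) (norm_nonneg _))
  refine ⟨m * r / 2, 1 / m, by positivity, by positivity, fun f hf hfε => ?_⟩
  set g : StrainSpace := ⟨gOf f, memℓp_two_iff.2 (gOf_sq_summable hf)⟩ with hg
  have hgnorm : ‖g‖ ≤ dualNorm f := by
    rw [StrainSpace.norm_eq_l2]
    exact l2_gOf_le_dualNorm hf
  obtain ⟨x, hx, hTx⟩ := exists_eq_of_strongly_monotone (T := residualOp h hK) hm0
    (le_max_right (6 * K) m) hr0 hmono hlip (g := g)
    (by rw [hT₀, sub_zero]; exact hgnorm.trans hfε.le)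
  have hpair : ∀ (w : StrainSpace) (v : ℕ → ℝ), du v = w → pairF f v = inner ℝ g w := by
    intro w v hv
    rw [pairF, hv, StrainSpace.inner_eq]
  have hest : m * ‖x - x₀‖ ≤ ‖g‖ := by
    have h1 := hmono x hx x₀ (Metric.mem_closedBall_self hr0.le)
    rw [hT₀, sub_zero, hTx] at h1
    have h2 := h1.trans (real_inner_le_norm _ _)
    rcases (norm_nonneg (x - x₀)).eq_or_lt with h0 | h0
    · rw [← h0, mul_zero]; exact norm_nonneg _
    · refine le_of_mul_le_mul_right ?_ h0
      linarith [sq ‖x - x₀‖, mul_assoc m ‖x - x₀‖ ‖x - x₀‖, congrArg (m * ·) (sq ‖x - x₀‖)]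
  have hxr : ‖x - x₀‖ < r / 2 := by
    by_contra! hcon
    have := mul_le_mul_of_nonneg_left hcon hm0.le
    linarith
  refine ⟨fun n => ∑ i ∈ Finset.range n, x i, memU_sum_range x, fun v hv => ?_,
    ⟨m, hm0, fun v hv => ?_⟩, ⟨r / 2, by positivity, fun u' hu' hclose hsol => ?_⟩, ?_⟩
  · rw [du_sum_range, fvA_eq_inner h hK x hv.strain rfl, hTx, hpair hv.strain v rfl]
  · rw [du_sum_range, svA_eq_hessForm]
    have h1 := (abs_le.1 (hK.abs_hessForm_sub_le (e₀ := x₀) hv.2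
      (fun ℓ => (StrainSpace.abs_apply_le (x - x₀) ℓ).trans (mem_closedBall_iff_norm.1 hx)))).1
    rw [hKr] at h1
    have h2 : ca * ∑' ℓ, du v ℓ ^ 2 ≤ hessForm V Vs x₀ (du v) := hstab v hv
    have h3 : ca * ∑' ℓ, du v ℓ ^ 2 = m * ∑' ℓ, du v ℓ ^ 2 + m * ∑' ℓ, du v ℓ ^ 2 := by
      rw [hm]; ring
    linarith
  · set y : StrainSpace := hu'.strain with hy
    rw [du_sum_range] at hclose
    have hyx : ‖y - x‖ < r / 2 := by
      rw [StrainSpace.norm_eq_l2]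
      exact hclose
    have hyr : y ∈ Metric.closedBall x₀ r := by
      rw [mem_closedBall_iff_norm]
      have := norm_sub_le_norm_sub_add_norm_sub y x x₀
      linarith
    have hz : inner ℝ (residualOp h hK y - residualOp h hK x) (y - x) = 0 := by
      have hd := du_sum_range (y - x : StrainSpace)
      have := hsol _ (memU_sum_range (y - x))
      rw [hpair (y - x) _ hd, ← hu'.coe_strain, fvA_eq_inner h hK _ (y - x) hd] at this
      rw [inner_sub_left, hTx, sub_eq_zero]
      exact this
    have hyx0 : ‖y - x‖ ^ 2 ≤ 0 := by
      have := hmono y hyr x hx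
      rw [hz] at this
      by_contra! hcon
      linarith [mul_pos hm0 hcon]
    have hyx1 : y = x := by
      rw [← sub_eq_zero, ← norm_eq_zero]
      exact pow_eq_zero_iff two_ne_zero |>.1 (le_antisymm hyx0 (sq_nonneg _))
    intro ℓ
    rw [eq_sum_range_du hu'.1, ← hu'.coe_strain, ← hy, hyx1]
  · rw [du_sum_range]
    have h1 : l2 (fun ℓ => x ℓ - du ugr ℓ) = ‖x - x₀‖ := (StrainSpace.norm_eq_l2 (x - x₀)).symm
    rw [h1, one_div, inv_mul_eq_div, le_div_iff₀ hm0, mul_comm]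
    exact hest.trans hgnorm
end
end

section
/- The function u = 0 is the unique minimizer of the Cauchy–Born energy 𝓔^cb over 𝒰^cb. Its atomistic residual satisfies sup{|⟨δ𝓔ᵃ(0), v⟩| : v ∈ 𝒰, ‖v'‖_{ℓ²} = 1} = |∂_F V^surf(0)|. Consequently, every ground state u^a_gr of 𝓔ᵃ satisfies ‖(u^a_gr)' − 0‖_{ℓ²} ≥ M^{−1}|∂_F V^surf(0)|, where M is a global Lipschitz constant of δ𝓔ᵃ : 𝒰 → 𝒰* (which exists since all second derivatives of V and V^surf are bounded). -/
open scoped BigOperators ENNReal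
open Filter MeasureTheory

noncomputable section

/-- The displacement with a unit strain across the first bond and no strain elsewhere. -/
def surfaceStep (ℓ : ℕ) : ℝ := if ℓ = 0 then 0 else 1

@[simp] lemma du_surfaceStep_zero : du surfaceStep 0 = 1 := by simp [du, surfaceStep]

@[simp] lemma du_surfaceStep_succ (ℓ : ℕ) : du surfaceStep (ℓ + 1) = 0 := by
  simp [du, surfaceStep]

lemma hasSum_du_surfaceStep_sq : HasSum (fun ℓ => du surfaceStep ℓ ^ 2) 1 := by
  convert hasSum_single (f := fun ℓ => du surfaceStep ℓ ^ 2) 0 ?_ using 1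
  · simp
  · rintro (_ | ℓ) hℓ
    · exact absurd rfl hℓ
    · simp

lemma memU_surfaceStep : memU surfaceStep :=
  ⟨by simp [surfaceStep], hasSum_du_surfaceStep_sq.summable⟩

lemma l2_du_surfaceStep : l2 (du surfaceStep) = 1 := by
  rw [l2, hasSum_du_surfaceStep_sq.tsum_eq, Real.sqrt_one]

@[simp] lemma du_zero (ℓ : ℕ) : du (fun _ => 0) ℓ = 0 := by simp [du]

lemma memU_zero : memU (fun _ => 0) := ⟨rfl, by simp⟩

lemma abs_le_l2 {e : ℕ → ℝ} (he : Summable fun ℓ => e ℓ ^ 2) (k : ℕ) : |e k| ≤ l2 e :=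
  Real.abs_le_sqrt (he.le_tsum k fun _ _ => sq_nonneg _)

lemma fvA_surfaceStep (V : ℝ → ℝ → ℝ) (Vs : ℝ → ℝ) (e : ℕ → ℝ) :
    fvA V Vs e surfaceStep = deriv Vs (e 0) + d1V V (e 0) (e 1) := by
  simp [fvA]

namespace SiteAssumptions

variable {V : ℝ → ℝ → ℝ} {Vs : ℝ → ℝ}

lemma pos_of_ne (h : SiteAssumptions V Vs) {r s : ℝ} (hrs : 0 < r ^ 2 + s ^ 2) :
    0 < V r s := by
  obtain ⟨δ, hδ, hV⟩ := h.pos_away (√(r ^ 2 + s ^ 2) / 2) (by positivity)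
  exact hδ.trans_le (hV r s (half_lt_self (by positivity)))

lemma nonneg (h : SiteAssumptions V Vs) (r s : ℝ) : 0 ≤ V r s := by
  rcases (add_nonneg (sq_nonneg r) (sq_nonneg s)).eq_or_lt with h0 | h0
  · obtain rfl : r = 0 := by nlinarith
    obtain rfl : s = 0 := by nlinarith
    exact h.V_zero.ge
  · exact (h.pos_of_ne h0).le

lemma surf_nonneg (h : SiteAssumptions V Vs) (s : ℝ) : 0 ≤ Vs s :=
  ge_of_tendsto' (h.surf_limit s) fun r => h.nonneg r s

lemma d1V_zero_s3 (h : SiteAssumptions V Vs) : d1V V 0 0 = 0 :=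
  IsLocalMin.deriv_eq_zero (.of_forall fun t => by simpa [h.V_zero] using h.nonneg t 0)

lemma d2V_zero_s3 (h : SiteAssumptions V Vs) : d2V V 0 0 = 0 :=
  IsLocalMin.deriv_eq_zero (.of_forall fun t => by simpa [h.V_zero] using h.nonneg 0 t)

lemma differentiable_left (h : SiteAssumptions V Vs) (s : ℝ) :
    Differentiable ℝ fun t => V t s :=
  (h.smooth_V.differentiable (by norm_num)).comp
    (differentiable_id.prodMk (differentiable_const s))

lemma continuous_Wcb (h : SiteAssumptions V Vs) : Continuous (Wcb V) :=
  h.smooth_V.continuous.comp (continuous_id.prodMk continuous_id)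

lemma EcbE_zero (h : SiteAssumptions V Vs) : EcbE V (fun _ => 0) = 0 := by
  simp [EcbE, Wcb, h.V_zero]

lemma eq_zero_of_Wcb_nonpos (h : SiteAssumptions V Vs) {F : ℝ} (hF : Wcb V F ≤ 0) : F = 0 := by
  by_contra hne
  exact hF.not_gt (h.pos_of_ne (by positivity))

lemma ae_eq_zero_of_EcbE_eq_zero (h : SiteAssumptions V Vs) {w : ℝ → ℝ}
    (hw : AEMeasurable w (volume.restrict (Set.Ioi 0))) (h0 : EcbE V w = 0) :
    w =ᵐ[volume.restrict (Set.Ioi (0 : ℝ))] fun _ => (0 : ℝ) := by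
  have hWw := (h.continuous_Wcb.measurable.comp_aemeasurable hw).ennreal_ofReal
  filter_upwards [(lintegral_eq_zero_iff' hWw).mp h0] with x hx
  exact h.eq_zero_of_Wcb_nonpos (ENNReal.ofReal_eq_zero.mp hx)

lemma fvA_zero (h : SiteAssumptions V Vs) (v : ℕ → ℝ) :
    fvA V Vs (fun _ => 0) v = du v 0 * deriv Vs 0 := by
  simp [fvA, h.d1V_zero_s3, h.d2V_zero_s3]

lemma EaE_zero (h : SiteAssumptions V Vs) :
    EaE V Vs (fun _ => 0) = ENNReal.ofReal (Vs 0) := by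
  simp [EaE, h.V_zero]

/-- The Euler–Lagrange equation of a ground state at the surface bond. -/
lemma surface_euler_lagrange (h : SiteAssumptions V Vs) {u : ℕ → ℝ} (hu : GroundState V Vs u) :
    deriv Vs (du u 0) + d1V V (du u 0) (du u 1) = 0 := by
  set tail : ℝ≥0∞ := ∑' ℓ : ℕ, ENNReal.ofReal (V (du u (ℓ + 1)) (du u (ℓ + 2))) with htail
  have split (w : ℕ → ℝ) (hw : ∀ ℓ, du w (ℓ + 1) = du u (ℓ + 1)) :
      EaE V Vs w = ENNReal.ofReal (Vs (du w 0) + V (du w 0) (du u 1)) + tail := by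
    rw [EaE, tsum_eq_zero_add' ENNReal.summable, ENNReal.ofReal_add (h.surf_nonneg _) (h.nonneg _ _),
      add_assoc]
    simp [hw, htail, add_assoc]
  have tail_ne_top : tail ≠ ⊤ := by
    refine ne_top_of_le_ne_top ?_ (le_add_self.trans_eq (split u fun _ => rfl).symm)
    refine ne_top_of_le_ne_top ?_ (hu.2 _ memU_zero)
    simp [h.EaE_zero]
  have isMin : IsLocalMin (fun t => Vs t + V t (du u 1)) (du u 0) := .of_forall fun t => by
    let w : ℕ → ℝ := fun ℓ => u ℓ + (t - du u 0) * surfaceStep ℓ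
    have du_w (ℓ : ℕ) : du w ℓ = du u ℓ + (t - du u 0) * du surfaceStep ℓ := by
      simp only [du, w]; ring
    have hw (ℓ : ℕ) : du w (ℓ + 1) = du u (ℓ + 1) := by simp [du_w]
    have memU_w : memU w := by
      refine ⟨by simp [w, surfaceStep, hu.1.1], (summable_nat_add_iff 1).mp ?_⟩
      simpa only [hw] using (summable_nat_add_iff 1).mpr hu.1.2
    have key := hu.2 w memU_w
    rw [split u fun _ => rfl, split w hw, ENNReal.add_le_add_iff_right tail_ne_top,
      ENNReal.ofReal_le_ofReal_iff (add_nonneg (h.surf_nonneg _) (h.nonneg _ _))] at key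
    simpa [du_w] using key
  have hVs : DifferentiableAt ℝ Vs (du u 0) := h.smooth_Vs.differentiable (by norm_num) _
  rw [d1V, ← deriv_fun_add hVs (h.differentiable_left _ _)]
  exact isMin.deriv_eq_zero

end SiteAssumptions

/-- `u = 0` is the unique minimizer of the Cauchy–Born energy;
its atomistic residual equals `|∂_F V^surf(0)|`; consequently every ground
state is at distance at least `M⁻¹|∂_F V^surf(0)|` from 0. -/
theorem cb_consistency_error_at_surface (V : ℝ → ℝ → ℝ) (Vs : ℝ → ℝ)
    (h : SiteAssumptions V Vs) :
    -- (1) u = 0 minimizes 𝓔^cb over 𝒰^cb ...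
    (∀ w : ℝ → ℝ, MemLp w 2 (volume.restrict (Set.Ioi 0)) →
      EcbE V (fun _ => 0) ≤ EcbE V w) ∧
    -- ... and it is the unique minimizer
    (∀ w : ℝ → ℝ, MemLp w 2 (volume.restrict (Set.Ioi 0)) →
      EcbE V w = EcbE V (fun _ => 0) →
      w =ᵐ[volume.restrict (Set.Ioi (0 : ℝ))] (fun _ => (0 : ℝ))) ∧
    -- (2) atomistic residual of u = 0
    (sSup {y : ℝ | ∃ v : ℕ → ℝ, memU v ∧ l2 (du v) = 1 ∧
        y = |fvA V Vs (fun _ => 0) v|} = |deriv Vs 0|) ∧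
    -- (3) lower bound on the ground state error of the Cauchy–Born solution
    (∀ M : ℝ, 0 < M →
      (∀ u1 u2 v : ℕ → ℝ, memU u1 → memU u2 → memU v →
        |fvA V Vs (du u1) v - fvA V Vs (du u2) v| ≤
          M * l2 (fun ℓ => du u1 ℓ - du u2 ℓ) * l2 (du v)) →
      ∀ ugr : ℕ → ℝ, GroundState V Vs ugr →
        |deriv Vs 0| / M ≤ l2 (du ugr)) := by
  refine ⟨fun w _ => h.EcbE_zero.trans_le zero_le, fun w hw h0 =>
    h.ae_eq_zero_of_EcbE_eq_zero hw.1.aemeasurable (h0.trans h.EcbE_zero), ?_, ?_⟩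
  · refine IsGreatest.csSup_eq ⟨⟨surfaceStep, memU_surfaceStep, l2_du_surfaceStep, ?_⟩, ?_⟩
    · simp [h.fvA_zero]
    · rintro _ ⟨v, hv, hv1, rfl⟩
      rw [h.fvA_zero, abs_mul]
      exact mul_le_of_le_one_left (abs_nonneg _) (hv1 ▸ abs_le_l2 hv.2 0)
  · intro M hM hLip u hu
    have key := hLip u (fun _ => 0) surfaceStep hu.1 memU_zero memU_surfaceStep
    simp only [fvA_surfaceStep, h.surface_euler_lagrange hu, du_zero, h.d1V_zero_s3,
      l2_du_surfaceStep, add_zero, zero_sub, abs_neg, sub_zero, mul_one] at key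
    exact (div_le_iff₀' hM).mpr key
end
end
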